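/- Closed form of convergence in the S topology (Theorem 3.2): For x_n, x_0 ∈ D([0,T]), x_n ⇒*_S x_0 if and only if x_n(T) → x_0(T) and ∫_0^T x_n(t) dA_n(t) → ∫_0^T x_0(t) dA_0(t) for every sequence A_n, A_0 ∈ 𝔸 with A_n →_τ A_0. -/

import Mathlib

open MeasureTheory Filter Set Topology

noncomputable section

/-- `x` is càdlàg on `[0,T]`: right-continuous at every `t ∈ [0,T)` and
admitting a left limit at every `t ∈ (0,T]`. -/
def Cadlag (T : ℝ) (x : ℝ → ℝ) : Prop :=
  (∀ t ∈ Set.Ico (0:ℝ) T, Filter.Tendsto x (nhdsWithin t (Set.Ioi t)) (nhds (x t))) ∧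
  (∀ t ∈ Set.Ioc (0:ℝ) T, ∃ L : ℝ, Filter.Tendsto x (nhdsWithin t (Set.Iio t)) (nhds L))

/-- membership in `𝕍`: càdlàg of finite total variation on `[0,T]`. -/
def MemV (T : ℝ) (v : ℝ → ℝ) : Prop :=
  Cadlag T v ∧ BoundedVariationOn v (Set.Icc 0 T)

/-- `μ` is the finite signed (Lebesgue–Stieltjes) measure induced by `v` on `[0,T]`:
`μ([0,t]) = v(t)` for `t ∈ [0,T]`, and `μ` vanishes outside `[0,T]`. -/
def Represents (T : ℝ) (μ : MeasureTheory.SignedMeasure ℝ) (v : ℝ → ℝ) : Prop :=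
  (∀ t ∈ Set.Icc (0:ℝ) T, μ (Set.Icc 0 t) = v t) ∧
  (∀ s : Set ℝ, MeasurableSet s → s ∩ Set.Icc (0:ℝ) T = ∅ → μ s = 0)

/-- Integral of `f` against a signed measure. -/
noncomputable def sInt (μ : MeasureTheory.SignedMeasure ℝ) (f : ℝ → ℝ) : ℝ :=
  (∫ t, f t ∂μ.toJordanDecomposition.posPart) - (∫ t, f t ∂μ.toJordanDecomposition.negPart)

/-- `∫_{[0,T]} f dv` : integral of `f` with respect to the Lebesgue–Stieltjes
signed measure induced by `v` on `[0,T]`. -/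
noncomputable def intD (T : ℝ) (f v : ℝ → ℝ) : ℝ :=
  letI := Classical.propDecidable (∃ μ : MeasureTheory.SignedMeasure ℝ, Represents T μ v)
  if h : ∃ μ : MeasureTheory.SignedMeasure ℝ, Represents T μ v then sInt h.choose f else 0

/-- S-convergence `x_n →_S x₀` on `D([0,T])`. -/
def SConv (T : ℝ) (x : ℕ → ℝ → ℝ) (x₀ : ℝ → ℝ) : Prop :=
  ∀ ε > (0:ℝ), ∃ v : ℕ → ℝ → ℝ, ∃ v₀ : ℝ → ℝ,
    (∀ n, MemV T (v n)) ∧ MemV T v₀ ∧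
    (∀ n, ∀ t ∈ Set.Icc (0:ℝ) T, |x n t - v n t| ≤ ε) ∧
    (∀ t ∈ Set.Icc (0:ℝ) T, |x₀ t - v₀ t| ≤ ε) ∧
    (∀ f : ℝ → ℝ, Continuous f →
      Filter.Tendsto (fun n => intD T f (v n)) Filter.atTop (nhds (intD T f v₀)))

/-- `x_n ⇒*_S x₀` : every subsequence contains a further subsequence `→_S`-converging to `x₀`. -/
def SStarConv (T : ℝ) (x : ℕ → ℝ → ℝ) (x₀ : ℝ → ℝ) : Prop :=
  ∀ φ : ℕ → ℕ, StrictMono φ →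
    ∃ ψ : ℕ → ℕ, StrictMono ψ ∧ SConv T (fun k => x (φ (ψ k))) x₀

/-- membership in `𝔸([0,T])`: continuous, of finite variation, vanishing at `0`. -/
def MemA (T : ℝ) (A : ℝ → ℝ) : Prop :=
  ContinuousOn A (Set.Icc 0 T) ∧ BoundedVariationOn A (Set.Icc 0 T) ∧ A 0 = 0

/-- `A_n →_τ A₀` : uniform convergence on `[0,T]` together with uniformly bounded
total variations. -/
def TauConv (T : ℝ) (A : ℕ → ℝ → ℝ) (A₀ : ℝ → ℝ) : Prop :=
  TendstoUniformlyOn (fun n => A n) A₀ Filter.atTop (Set.Icc 0 T) ∧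
  ∃ M : ℝ, ∀ n, eVariationOn (A n) (Set.Icc 0 T) ≤ ENNReal.ofReal M

/-- `x` has (at least) `k` up-crossings of the levels `a < b` on `[0,T]`. -/
def HasUpcrossings (T a b : ℝ) (x : ℝ → ℝ) (k : ℕ) : Prop :=
  ∃ s u : Fin k → ℝ, (∀ i, 0 ≤ s i ∧ s i < u i ∧ u i ≤ T) ∧
    (∀ i j : Fin k, i < j → u i < s j) ∧
    (∀ i, x (s i) < a ∧ b < x (u i))

/-- `x` has (at least) `k` `η`-oscillations on `[0,T]`. -/
def HasOscillations (T η : ℝ) (x : ℝ → ℝ) (k : ℕ) : Prop :=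
  ∃ s u : Fin k → ℝ, (∀ i, 0 ≤ s i ∧ s i < u i ∧ u i ≤ T) ∧
    (∀ i j : Fin k, i < j → u i ≤ s j) ∧
    (∀ i, |x (u i) - x (s i)| > η)


/-- The finite measures `P` and `Q` live on `[0,T]` and `P - Q` is the Lebesgue–Stieltjes
measure of `v`. -/
structure IsDiffRep (T : ℝ) (P Q : Measure ℝ) (v : ℝ → ℝ) : Prop where
  finite_left : IsFiniteMeasure P
  finite_right : IsFiniteMeasure Q
  left_compl : P (Icc 0 T)ᶜ = 0
  right_compl : Q (Icc 0 T)ᶜ = 0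
  apply_Icc : ∀ t ∈ Icc (0:ℝ) T, P.real (Icc 0 t) - Q.real (Icc 0 t) = v t

lemma measure_eq_of_Icc {T : ℝ} {P Q : Measure ℝ} [IsFiniteMeasure P] [IsFiniteMeasure Q]
    (hout : ∀ s : Set ℝ, MeasurableSet s → s ∩ Icc (0:ℝ) T = ∅ → P s = Q s)
    (hIcc : ∀ t ∈ Icc (0:ℝ) T, P (Icc 0 t) = Q (Icc 0 t)) : P = Q := by
  refine Measure.ext_of_Iic P Q fun a => ?_
  have hsplit : Iic a = (Iic a \ Icc 0 T) ∪ (Iic a ∩ Icc 0 T) := (sdiff_union_inter _ _).symm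
  have hd : Disjoint (Iic a \ Icc 0 T) (Iic a ∩ Icc 0 T) := disjoint_sdiff_inter
  rw [hsplit, measure_union hd (measurableSet_Iic.inter measurableSet_Icc),
    measure_union hd (measurableSet_Iic.inter measurableSet_Icc),
    hout _ (measurableSet_Iic.diff measurableSet_Icc) (by simp)]
  congr 1
  by_cases ha : 0 ≤ min a T
  · have : Iic a ∩ Icc 0 T = Icc 0 (min a T) := by
      ext t; simp only [mem_inter_iff, mem_Iic, mem_Icc, le_min_iff]; tauto
    rw [this]
    exact hIcc _ ⟨ha, min_le_right _ _⟩
  · have : Iic a ∩ Icc 0 T = ∅ := by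
      ext t
      simp only [mem_inter_iff, mem_Iic, mem_Icc, mem_empty_iff_false, iff_false]
      rintro ⟨h1, h2, h3⟩
      exact ha (le_min (h2.trans h1) (h2.trans h3))
    rw [this]; simp

/-- The integral `intD` may be computed from any difference representation. -/
lemma IsDiffRep.intD_eq {T : ℝ} {P Q : Measure ℝ} {v f : ℝ → ℝ} (h : IsDiffRep T P Q v)
    (hP : Integrable f P) (hQ : Integrable f Q) :
    intD T f v = ∫ t, f t ∂P - ∫ t, f t ∂Q := by
  have := h.finite_left
  have := h.finite_right
  have hzero : ∀ s : Set ℝ, s ∩ Icc (0:ℝ) T = ∅ → P s = 0 ∧ Q s = 0 := fun s hs => by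
    have hsub : s ⊆ (Icc 0 T)ᶜ :=
      subset_compl_iff_disjoint_right.2 (disjoint_iff_inter_eq_empty.2 hs)
    exact ⟨measure_mono_null hsub h.left_compl, measure_mono_null hsub h.right_compl⟩
  have hex : ∃ μ : SignedMeasure ℝ, Represents T μ v := by
    refine ⟨P.toSignedMeasure - Q.toSignedMeasure, fun t ht => ?_, fun s hs hs' => ?_⟩
    · rw [Measure.toSignedMeasure_sub_apply measurableSet_Icc]
      exact h.apply_Icc t ht
    · rw [Measure.toSignedMeasure_sub_apply hs]
      simp [Measure.real, hzero s hs']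
  have hD : intD T f v = sInt hex.choose f := by
    unfold intD; simp only [hex, dif_pos]
  rw [hD]
  set ν := hex.choose with hν
  obtain ⟨hν1, hν2⟩ : Represents T ν v := hex.choose_spec
  set J := ν.toJordanDecomposition with hJ
  have hνJ : ν = J.posPart.toSignedMeasure - J.negPart.toSignedMeasure :=
    (SignedMeasure.toSignedMeasure_toJordanDecomposition ν).symm
  have hreal : ∀ s, MeasurableSet s → ν s = J.posPart.real s - J.negPart.real s := fun s hs => by
    rw [hνJ, Measure.toSignedMeasure_sub_apply hs]
  have hsum : J.posPart + Q = J.negPart + P := by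
    refine measure_eq_of_Icc (T := T) (fun s hs hs' => ?_) fun t ht => ?_
    · have := hν2 s hs hs'
      rw [hreal s hs, sub_eq_zero] at this
      rw [Measure.add_apply, Measure.add_apply, (hzero s hs').1, (hzero s hs').2]
      congr 1
      exact (measureReal_eq_measureReal_iff).1 this
    · refine (measureReal_eq_measureReal_iff).1 ?_
      rw [measureReal_add_apply, measureReal_add_apply]
      have h1 := hν1 t ht
      rw [hreal _ measurableSet_Icc] at h1
      have h2 := h.apply_Icc t ht
      linarith
  have hνPQ : ν = P.toSignedMeasure - Q.toSignedMeasure := by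
    have : J.posPart.toSignedMeasure + Q.toSignedMeasure
        = J.negPart.toSignedMeasure + P.toSignedMeasure := by
      rw [← Measure.toSignedMeasure_add, ← Measure.toSignedMeasure_add]
      exact Measure.toSignedMeasure_congr hsum
    rw [hνJ, sub_eq_sub_iff_add_eq_add, this, add_comm]
  have hJPQ : J = Measure.jordanDecompositionOfToSignedMeasureSub P Q := by
    rw [hJ, hνPQ, Measure.toJordanDecomposition_toSignedMeasure_sub]
  have hJP : J.posPart ≤ P := by
    rw [hJPQ, Measure.jordanDecompositionOfToSignedMeasureSub_posPart]; exact Measure.sub_le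
  have hJQ : J.negPart ≤ Q := by
    rw [hJPQ, Measure.jordanDecompositionOfToSignedMeasureSub_negPart]; exact Measure.sub_le
  have hi : ∫ t, f t ∂(J.posPart + Q) = ∫ t, f t ∂(J.negPart + P) := by rw [hsum]
  rw [integral_add_measure (hP.mono_measure hJP) hQ,
    integral_add_measure (hQ.mono_measure hJQ) hP] at hi
  change (∫ t, f t ∂J.posPart) - (∫ t, f t ∂J.negPart) = _
  linarith

/-- Every càdlàg function of bounded variation has a difference representation whose masses are
controlled by the variation and the initial value. -/
lemma exists_isDiffRep {T : ℝ} (hT : 0 < T) {v : ℝ → ℝ}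
    (hc : ∀ t ∈ Ico (0:ℝ) T, Tendsto v (𝓝[>] t) (𝓝 (v t)))
    (hv : BoundedVariationOn v (Icc 0 T)) :
    ∃ P Q : Measure ℝ, IsDiffRep T P Q v ∧
      P.real univ + Q.real univ ≤ 3 * (eVariationOn v (Icc 0 T)).toReal + |v 0| := by
  let π : ℝ → ℝ := fun t => max 0 (min T t)
  have hπ : Monotone π := fun a b hab => max_le_max le_rfl (min_le_min le_rfl hab)
  have hπm : ∀ t, π t ∈ Icc 0 T := fun t => ⟨le_max_left _ _, max_le hT.le (min_le_left _ _)⟩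
  have hπe : ∀ t ∈ Icc 0 T, π t = t := fun t ht => by
    simp [π, ht.1, ht.2]
  let g : ℝ → ℝ := v ∘ π
  have hgle : eVariationOn g univ ≤ eVariationOn v (Icc 0 T) :=
    eVariationOn.comp_le_of_monotoneOn v π (hπ.monotoneOn _) fun t _ => hπm t
  have hg : BoundedVariationOn g univ := ne_top_of_le_ne_top hv hgle
  have hgl := hg.locallyBoundedVariationOn
  have hgc : ∀ t, ContinuousWithinAt g (Ici t) t := by
    intro t
    rcases lt_or_ge t 0 with h | h
    · have : g =ᶠ[𝓝 t] fun _ => v 0 := by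
        filter_upwards [Iio_mem_nhds h] with s hs
        have : min T s ≤ 0 := (min_le_right _ _).trans (le_of_lt hs)
        simp [g, π, this]
      exact (continuousAt_const.congr this.symm).continuousWithinAt
    rcases lt_or_ge t T with h' | h'
    · rw [← continuousWithinAt_Ioi_iff_Ici]
      have hgt : g t = v t := by simp [g, hπe t ⟨h, h'.le⟩]
      unfold ContinuousWithinAt
      rw [hgt]
      refine (hc t ⟨h, h'⟩).congr' ?_
      filter_upwards [Ioo_mem_nhdsGT h'] with s hs
      simp [g, hπe s ⟨h.trans hs.1.le, hs.2.le⟩]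
    · refine continuousWithinAt_const.congr (f := fun _ => v T) (fun s hs => ?_) ?_
      · have : min T s = T := min_eq_left (h'.trans hs)
        simp [g, π, this, hT.le]
      · simp [g, π, h', hT.le]
  let p : StieltjesFunction ℝ :=
    { toFun := variationOnFromTo g univ 0
      mono' := monotoneOn_univ.1 (variationOnFromTo.monotoneOn hgl (mem_univ _))
      right_continuous' := fun x => hg.continuousWithinAt_variationOnFromTo_Ici (hgc x) }
  let q : StieltjesFunction ℝ :=
    { toFun := variationOnFromTo g univ 0 - g
      mono' := monotoneOn_univ.1 (variationOnFromTo.sub_self_monotoneOn hgl (mem_univ _))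
      right_continuous' := fun x =>
        (hg.continuousWithinAt_variationOnFromTo_Ici (hgc x)).sub (hgc x) }
  have hpq : ∀ t, p t - q t = g t := fun t => by simp [p, q]
  have hg0 : g 0 = v 0 := by simp [g, hπe 0 ⟨le_rfl, hT.le⟩]
  have hmass : ∀ (r : StieltjesFunction ℝ) (c : ℝ), ∀ t ∈ Icc (0:ℝ) T,
      (r.measure.restrict (Ioc 0 T) + ENNReal.ofReal c • Measure.dirac (0:ℝ)).real (Icc 0 t)
        = r t - r 0 + max c 0 := by
    intro r c t ht
    have hfin : (r.measure.restrict (Ioc 0 T)) (Icc 0 t) ≠ ⊤ := by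
      rw [Measure.restrict_apply measurableSet_Icc]
      refine ne_top_of_le_ne_top ?_ (measure_mono inter_subset_right)
      rw [r.measure_Ioc]; exact ENNReal.ofReal_ne_top
    have hi : Icc 0 t ∩ Ioc 0 T = Ioc 0 t := by
      ext s; simp only [mem_inter_iff, mem_Icc, mem_Ioc]
      exact ⟨fun h => ⟨h.2.1, h.1.2⟩, fun h => ⟨⟨h.1.le, h.2⟩, h.1, h.2.trans ht.2⟩⟩
    rw [measureReal_add_apply hfin (by simp [ht.1])]
    simp only [Measure.real]
    rw [Measure.restrict_apply measurableSet_Icc, hi, r.measure_Ioc]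
    rw [ENNReal.toReal_ofReal (sub_nonneg.2 (r.mono ht.1))]
    simp [ht.1, ENNReal.toReal_ofReal']
  have hfinm : ∀ (r : StieltjesFunction ℝ) (c : ℝ),
      IsFiniteMeasure (r.measure.restrict (Ioc 0 T) + ENNReal.ofReal c • Measure.dirac (0:ℝ)) := by
    intro r c
    have h1 : IsFiniteMeasure (r.measure.restrict (Ioc 0 T)) :=
      ⟨by rw [Measure.restrict_apply_univ, r.measure_Ioc]; exact ENNReal.ofReal_lt_top⟩
    have h2 : IsFiniteMeasure (ENNReal.ofReal c • Measure.dirac (0:ℝ)) :=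
      Measure.smul_finite _ ENNReal.ofReal_ne_top
    infer_instance
  have hcompl : ∀ (r : StieltjesFunction ℝ) (c : ℝ),
      (r.measure.restrict (Ioc 0 T) + ENNReal.ofReal c • Measure.dirac (0:ℝ)) (Icc 0 T)ᶜ = 0 := by
    intro r c
    rw [Measure.add_apply, Measure.restrict_apply measurableSet_Icc.compl]
    have : (Icc 0 T)ᶜ ∩ Ioc 0 T = ∅ := by
      rw [inter_comm, ← sdiff_eq]; exact sdiff_eq_empty.2 Ioc_subset_Icc_self
    simp [this, hT.le]
  have huniv : ∀ (r : StieltjesFunction ℝ) (c : ℝ),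
      (r.measure.restrict (Ioc 0 T) + ENNReal.ofReal c • Measure.dirac (0:ℝ)).real univ
        = r T - r 0 + max c 0 := by
    intro r c
    have := hfinm r c
    rw [← hmass r c T ⟨hT.le, le_rfl⟩]
    have h0 : (r.measure.restrict (Ioc 0 T) + ENNReal.ofReal c • Measure.dirac (0:ℝ)).real
        (Icc 0 T)ᶜ = 0 := by rw [Measure.real, hcompl r c]; rfl
    rw [← measureReal_add_measureReal_compl (measurableSet_Icc (a := (0:ℝ)) (b := T)), h0, add_zero]
  have hmaxsub : ∀ c : ℝ, max c 0 - max (-c) 0 = c := fun c => by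
    rcases le_total 0 c with h | h <;> simp [h]
  have hmaxadd : ∀ c : ℝ, max c 0 + max (-c) 0 = |c| := fun c => by
    rcases le_total 0 c with h | h <;> simp [h, abs_of_nonneg, abs_of_nonpos]
  refine ⟨p.measure.restrict (Ioc 0 T) + ENNReal.ofReal (v 0) • Measure.dirac (0:ℝ),
    q.measure.restrict (Ioc 0 T) + ENNReal.ofReal (-v 0) • Measure.dirac (0:ℝ),
    ⟨hfinm _ _, hfinm _ _, hcompl _ _, hcompl _ _, fun t ht => ?_⟩, ?_⟩
  · rw [hmass _ _ t ht, hmass _ _ t ht]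
    have h1 := hpq t
    have h2 := hpq 0
    have h3 : g t = v t := by simp [g, hπe t ht]
    have h4 := hmaxsub (v 0)
    linarith
  · rw [huniv, huniv]
    have h1 := hpq T
    have h2 := hpq 0
    have h4 := hmaxadd (v 0)
    have hpT : p T ≤ (eVariationOn g univ).toReal :=
      (le_abs_self _).trans (variationOnFromTo.abs_le_eVariationOn hg)
    have hp0 : p 0 = 0 := variationOnFromTo.self g univ 0
    have hgT : |g T - g 0| ≤ p T - p 0 :=
      variationOnFromTo.abs_sub_le_sub_of_le hgl (mem_univ _) (mem_univ _) (mem_univ _) hT.le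
    have hVV : (eVariationOn g univ).toReal ≤ (eVariationOn v (Icc 0 T)).toReal :=
      ENNReal.toReal_mono hv hgle
    have := neg_abs_le (g T - g 0)
    linarith

/-- `Osc x ε k t`: the function `x` has `k` consecutive oscillations larger than `ε` on `[0,t]`. -/
def Osc (x : ℝ → ℝ) (ε : ℝ) : ℕ → ℝ → Prop
  | 0, t => 0 ≤ t
  | k + 1, t => ∃ s u, Osc x ε k s ∧ s < u ∧ u ≤ t ∧ ε < |x u - x s|

/-- The first time before `T` after which `x` has `k` oscillations larger than `ε`, or `T`. -/
def oscTime (T : ℝ) (x : ℝ → ℝ) (ε : ℝ) (k : ℕ) : ℝ :=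
  sInf (insert T {t | t < T ∧ Osc x ε k t})

section Oscillations

variable {T : ℝ} {x : ℝ → ℝ} {ε : ℝ}

lemma Osc.mono {k : ℕ} {s t : ℝ} (h : Osc x ε k s) (hst : s ≤ t) : Osc x ε k t := by
  cases k with
  | zero => exact le_trans (show 0 ≤ s from h) hst
  | succ k =>
    obtain ⟨a, b, h1, h2, h3, h4⟩ := h
    exact ⟨a, b, h1, h2, h3.trans hst, h4⟩

lemma Osc.of_succ {k : ℕ} {t : ℝ} (h : Osc x ε (k + 1) t) : Osc x ε k t := by
  obtain ⟨a, b, h1, h2, h3, h4⟩ := h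
  exact h1.mono (h2.le.trans h3)

lemma Osc.nonneg {k : ℕ} {t : ℝ} (h : Osc x ε k t) : 0 ≤ t := by
  induction k with
  | zero => exact h
  | succ k ih => exact ih h.of_succ

lemma bddBelow_oscSet (hT : 0 < T) (k : ℕ) :
    BddBelow (insert T {t | t < T ∧ Osc x ε k t}) := by
  refine ⟨0, ?_⟩
  rintro t (rfl | ht)
  · exact hT.le
  · exact ht.2.nonneg

lemma oscTime_mem (hT : 0 < T) (k : ℕ) : oscTime T x ε k ∈ Icc 0 T := by
  refine ⟨le_csInf ⟨T, mem_insert _ _⟩ ?_, csInf_le (bddBelow_oscSet hT k) (mem_insert _ _)⟩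
  rintro t (rfl | ht)
  · exact hT.le
  · exact ht.2.nonneg

lemma oscTime_le (hT : 0 < T) {k : ℕ} {t : ℝ} (ht : t < T) (h : Osc x ε k t) :
    oscTime T x ε k ≤ t :=
  csInf_le (bddBelow_oscSet hT k) (mem_insert_of_mem _ ⟨ht, h⟩)

lemma osc_of_oscTime_lt {k : ℕ} {t : ℝ} (ht : t < T) (h : oscTime T x ε k < t) :
    Osc x ε k t := by
  obtain ⟨s, hs, hst⟩ := exists_lt_of_csInf_lt ⟨T, mem_insert _ _⟩ h
  rcases hs with rfl | hs
  · exact absurd ht hst.not_gt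
  · exact hs.2.mono hst.le

lemma not_osc_of_lt_oscTime (hT : 0 < T) {k : ℕ} {t : ℝ} (h : t < oscTime T x ε k) :
    ¬ Osc x ε k t := fun ho =>
  absurd (oscTime_le hT (h.trans_le (oscTime_mem hT k).2) ho) h.not_ge

lemma oscTime_zero (hT : 0 < T) : oscTime T x ε 0 = 0 :=
  le_antisymm (oscTime_le hT hT (le_refl (0:ℝ))) (oscTime_mem hT 0).1

lemma oscTime_monotone (hT : 0 < T) : Monotone (oscTime T x ε) := by
  refine monotone_nat_of_le_succ fun k => ?_
  refine csInf_le_csInf (bddBelow_oscSet hT k) ⟨T, mem_insert _ _⟩ ?_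
  exact insert_subset_insert fun t ht => ⟨ht.1, ht.2.of_succ⟩

lemma abs_sub_le_of_mem_Ioo_oscTime (hT : 0 < T) (hε : 0 < ε) {k : ℕ} {s t : ℝ}
    (hs : oscTime T x ε k < s) (hst : s ≤ t) (ht : t < oscTime T x ε (k + 1)) :
    |x t - x s| ≤ ε := by
  rcases hst.eq_or_lt with rfl | hst
  · simpa using hε.le
  by_contra! hcon
  have htT := ht.trans_le (oscTime_mem hT _).2
  exact not_osc_of_lt_oscTime hT ht
    ⟨s, t, osc_of_oscTime_lt (hst.trans htT) hs, hst, le_rfl, hcon⟩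

lemma abs_sub_oscTime_le (hT : 0 < T) (hε : 0 < ε) (hx : Cadlag T x) {k : ℕ} {t : ℝ}
    (hk : oscTime T x ε k ≤ t) (ht : t < oscTime T x ε (k + 1)) :
    |x t - x (oscTime T x ε k)| ≤ ε := by
  rcases hk.eq_or_lt with h | h
  · rw [h]; simpa using hε.le
  have htT := ht.trans_le (oscTime_mem hT _).2
  have hlim := hx.1 (oscTime T x ε k) ⟨(oscTime_mem hT k).1, h.trans htT⟩
  have := (hlim.const_sub (x t)).abs
  refine le_of_tendsto this ?_
  filter_upwards [Ioo_mem_nhdsGT h] with s hs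
  exact abs_sub_le_of_mem_Ioo_oscTime hT hε hs.1 hs.2.le ht

lemma oscTime_lt_succ (hT : 0 < T) (hε : 0 < ε) (hx : Cadlag T x) {k : ℕ}
    (hk : oscTime T x ε k < T) : oscTime T x ε k < oscTime T x ε (k + 1) := by
  set a := oscTime T x ε k with ha
  have hlim := hx.1 a ⟨(oscTime_mem hT k).1, hk⟩
  have hev : ∀ᶠ s in 𝓝[>] a, |x s - x a| < ε / 2 := by
    have := Metric.tendsto_nhds.1 hlim (ε / 2) (half_pos hε)
    simpa [Real.dist_eq] using this
  obtain ⟨b, hb, hb'⟩ := (mem_nhdsGT_iff_exists_Ioo_subset).1 hev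
  have hclose : ∀ s, a ≤ s → s < b → |x s - x a| < ε / 2 := fun s h1 h2 => by
    rcases h1.eq_or_lt with rfl | h1
    · simpa using half_pos hε
    · exact hb' ⟨h1, h2⟩
  refine (lt_min hb hk).trans_le (le_csInf ⟨T, mem_insert _ _⟩ ?_)
  rintro t (rfl | ⟨htT, s, u, h1, h2, h3, h4⟩)
  · exact min_le_right _ _
  refine (min_le_left _ _).trans ?_
  by_contra! hcon
  have hub := h3.trans_lt hcon
  have hs : a ≤ s := oscTime_le hT (h2.trans (h3.trans_lt htT)) h1
  have e1 := abs_lt.1 (hclose s hs (h2.trans hub))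
  have e2 := abs_lt.1 (hclose u (hs.trans h2.le) hub)
  have : |x u - x s| < ε := abs_lt.2 ⟨by linarith, by linarith⟩
  linarith

lemma exists_oscTime_eq (hT : 0 < T) (hε : 0 < ε) (hx : Cadlag T x) :
    ∃ K, oscTime T x ε K = T := by
  by_contra! hne
  have hlt : ∀ k, oscTime T x ε k < T := fun k => lt_of_le_of_ne (oscTime_mem hT k).2 (hne k)
  have hstrict : StrictMono (oscTime T x ε) :=
    strictMono_nat_of_lt_succ fun k => oscTime_lt_succ hT hε hx (hlt k)
  have hbdd : BddAbove (range (oscTime T x ε)) := ⟨T, by rintro _ ⟨k, rfl⟩; exact (hlt k).le⟩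
  set a := ⨆ k, oscTime T x ε k with ha
  have hlta : ∀ k, oscTime T x ε k < a := fun k =>
    (hstrict k.lt_succ_self).trans_le (le_ciSup hbdd (k + 1))
  have ha0 : 0 < a := by simpa [oscTime_zero hT] using hlta 0
  have haT : a ≤ T := ciSup_le fun k => (hlt k).le
  obtain ⟨L, hL⟩ := hx.2 a ⟨ha0, haT⟩
  have hev : ∀ᶠ s in 𝓝[<] a, |x s - L| < ε / 2 := by
    have := Metric.tendsto_nhds.1 hL (ε / 2) (half_pos hε)
    simpa [Real.dist_eq] using this
  obtain ⟨b, hb, hb'⟩ := (mem_nhdsLT_iff_exists_Ioo_subset).1 hev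
  replace hb' : ∀ s ∈ Ioo b a, |x s - L| < ε / 2 := fun s hs => hb' hs
  obtain ⟨k, hk⟩ := exists_lt_of_lt_ciSup (show b < ⨆ k, oscTime T x ε k from hb)
  obtain ⟨t, hkt, hta⟩ := exists_between (hlta (k + 1))
  obtain ⟨s, u, h1, h2, h3, h4⟩ := osc_of_oscTime_lt (hta.trans_le haT) hkt
  have hs : oscTime T x ε k ≤ s := oscTime_le hT (h2.trans (h3.trans_lt (hta.trans_le haT))) h1
  have e1 := abs_lt.1 (hb' _ ⟨hk.trans_le hs, h2.trans (h3.trans_lt hta)⟩)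
  have e2 := abs_lt.1 (hb' _ ⟨(hk.trans_le hs).trans h2, h3.trans_lt hta⟩)
  have : |x u - x s| < ε := abs_lt.2 ⟨by linarith, by linarith⟩
  linarith

end Oscillations

/-- The step function with jumps `c j` at the points `a j`, `j ≤ K`. -/
def stepFn (K : ℕ) (c a : ℕ → ℝ) (t : ℝ) : ℝ :=
  ∑ j ∈ Finset.range (K + 1), if a j ≤ t then c j else 0

/-- The successive increments of `x` along `a`, starting with the value `x (a 0)`. -/
def increments (x : ℝ → ℝ) (a : ℕ → ℝ) : ℕ → ℝ
  | 0 => x (a 0)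
  | j + 1 => x (a (j + 1)) - x (a j)

lemma sum_increments (x : ℝ → ℝ) (a : ℕ → ℝ) (j : ℕ) :
    ∑ i ∈ Finset.range (j + 1), increments x a i = x (a j) := by
  induction j with
  | zero => simp [increments]
  | succ j ih => rw [Finset.sum_range_succ, ih, increments]; ring

lemma stepFn_increments {x : ℝ → ℝ} {a : ℕ → ℝ} (ha : Monotone a) {K j : ℕ} {t : ℝ} (hjK : j ≤ K)
    (hj : a j ≤ t) (hj' : ∀ i, j < i → i ≤ K → t < a i) :
    stepFn K (increments x a) a t = x (a j) := by
  rw [stepFn, ← sum_increments x a j]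
  symm
  have hsub : Finset.range (j + 1) ⊆ Finset.range (K + 1) := Finset.range_mono (by omega)
  rw [← Finset.sum_subset hsub (f := fun i => if a i ≤ t then increments x a i else 0)]
  · refine Finset.sum_congr rfl fun i hi => ?_
    rw [if_pos ((ha (Nat.lt_succ_iff.1 (Finset.mem_range.1 hi))).trans hj)]
  · intro i hi hi'
    simp only [Finset.mem_range] at hi hi'
    exact if_neg (hj' i (by omega) (by omega)).not_ge

lemma exists_stepFn_oscTime_eq {T ε : ℝ} {x : ℝ → ℝ} (hT : 0 < T) (hε : 0 < ε)
    (hx : Cadlag T x) {K : ℕ} (hK : oscTime T x ε K = T) {t : ℝ} (ht : t ∈ Icc 0 T) :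
    ∃ j ≤ K, |x t - x (oscTime T x ε j)| ≤ ε ∧
      stepFn K (increments x (oscTime T x ε)) (oscTime T x ε) t = x (oscTime T x ε j) := by
  classical
  set a := oscTime T x ε with ha
  set j := Nat.findGreatest (fun j => a j ≤ t) K with hj
  have h0 : a 0 ≤ t := by rw [ha, oscTime_zero hT]; exact ht.1
  have hjt : a j ≤ t := Nat.findGreatest_spec (P := fun j => a j ≤ t) (Nat.zero_le K) h0
  have hjK : j ≤ K := Nat.findGreatest_le K
  have hgt : ∀ i, j < i → i ≤ K → t < a i := fun i h1 h2 =>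
    not_le.1 (Nat.findGreatest_is_greatest (P := fun j => a j ≤ t) h1 h2)
  refine ⟨j, hjK, ?_, stepFn_increments (oscTime_monotone hT) hjK hjt hgt⟩
  rcases hjK.eq_or_lt with h | h
  · have : t = a j := le_antisymm (by rw [h, hK]; exact ht.2) hjt
    rw [← this]; simpa using hε.le
  · exact abs_sub_oscTime_le hT hε hx hjt (hgt _ (Nat.lt_succ_self j) h)

lemma abs_sub_stepFn_oscTime_le {T ε : ℝ} {x : ℝ → ℝ} (hT : 0 < T) (hε : 0 < ε)
    (hx : Cadlag T x) {K : ℕ} (hK : oscTime T x ε K = T) {t : ℝ} (ht : t ∈ Icc 0 T) :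
    |x t - stepFn K (increments x (oscTime T x ε)) (oscTime T x ε) t| ≤ ε := by
  obtain ⟨j, -, h1, h2⟩ := exists_stepFn_oscTime_eq hT hε hx hK ht
  rwa [h2]

lemma measurable_stepFn (K : ℕ) (c a : ℕ → ℝ) : Measurable (stepFn K c a) :=
  Finset.measurable_sum _ fun _ _ =>
    Measurable.ite measurableSet_Ici measurable_const measurable_const

lemma Cadlag.exists_bound {T : ℝ} {x : ℝ → ℝ} (hT : 0 < T) (hx : Cadlag T x) :
    ∃ C, ∀ t ∈ Icc 0 T, |x t| ≤ C := by
  obtain ⟨K, hK⟩ := exists_oscTime_eq hT one_pos hx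
  refine ⟨∑ j ∈ Finset.range (K + 1), |x (oscTime T x 1 j)| + 1, fun t ht => ?_⟩
  obtain ⟨j, hj, h1, -⟩ := exists_stepFn_oscTime_eq hT one_pos hx hK ht
  have h2 := Finset.single_le_sum (f := fun j => |x (oscTime T x 1 j)|) (fun i _ => abs_nonneg _)
    (Finset.mem_range.2 (Nat.lt_succ_of_le hj))
  have h3 := abs_sub_abs_le_abs_sub (x t) (x (oscTime T x 1 j))
  linarith

lemma Cadlag.measurable_indicator {T : ℝ} {x : ℝ → ℝ} (hT : 0 < T) (hx : Cadlag T x) :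
    Measurable ((Icc 0 T).indicator x) := by
  have hε : ∀ m : ℕ, (0:ℝ) < 1 / (m + 1) := fun m => Nat.one_div_pos_of_nat
  choose K hK using fun m : ℕ => exists_oscTime_eq hT (hε m) hx
  refine measurable_of_tendsto_metrizable
    (f := fun m => (Icc 0 T).indicator (stepFn (K m)
      (increments x (oscTime T x (1 / ((m:ℝ) + 1)))) (oscTime T x (1 / ((m:ℝ) + 1)))))
    (fun m => (measurable_stepFn _ _ _).indicator measurableSet_Icc) ?_
  refine tendsto_pi_nhds.2 fun t => ?_
  by_cases ht : t ∈ Icc 0 T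
  · simp only [indicator_of_mem ht]
    refine tendsto_iff_dist_tendsto_zero.2 ?_
    refine squeeze_zero (fun _ => dist_nonneg) (fun m => ?_)
      (tendsto_one_div_add_atTop_nhds_zero_nat (𝕜 := ℝ))
    rw [dist_comm, Real.dist_eq]
    exact abs_sub_stepFn_oscTime_le hT (hε m) hx (hK m) ht
  · simp [indicator_of_notMem ht]

lemma Cadlag.integrable {T : ℝ} {x : ℝ → ℝ} (hT : 0 < T) (hx : Cadlag T x)
    {P : Measure ℝ} [IsFiniteMeasure P] (hP : P (Icc 0 T)ᶜ = 0) : Integrable x P := by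
  obtain ⟨C, hC⟩ := hx.exists_bound hT
  have hae : (Icc 0 T).indicator x =ᵐ[P] x := by
    filter_upwards [compl_mem_ae_iff.2 hP] with t ht
    exact indicator_of_mem (by simpa using ht) x
  refine Integrable.congr (f := (Icc 0 T).indicator x) ?_ hae
  refine Integrable.of_bound (hx.measurable_indicator hT).aestronglyMeasurable |C|
    (Eventually.of_forall fun t => ?_)
  by_cases ht : t ∈ Icc 0 T
  · rw [indicator_of_mem ht]; exact (hC t ht).trans (le_abs_self C)
  · rw [indicator_of_notMem ht]; simp

lemma ContinuousOn.cadlag {T : ℝ} {f : ℝ → ℝ} (hf : ContinuousOn f (Icc 0 T)) : Cadlag T f := by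
  refine ⟨fun t ht => ?_, fun t ht => ⟨f t, ?_⟩⟩
  · exact (hf t ⟨ht.1, ht.2.le⟩).mono_left
      (nhdsWithin_le_iff.2 (mem_of_superset (Ioo_mem_nhdsGT ht.2)
        fun s hs => ⟨ht.1.trans hs.1.le, hs.2.le⟩))
  · exact (hf t ⟨ht.1.le, ht.2⟩).mono_left
      (nhdsWithin_le_iff.2 (mem_of_superset (Ioo_mem_nhdsLT ht.1)
        fun s hs => ⟨hs.1.le, hs.2.le.trans ht.2⟩))

section Integral

variable {T : ℝ} {P Q : Measure ℝ} {v f g : ℝ → ℝ}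

lemma IsDiffRep.intD_eq_of_cadlag (h : IsDiffRep T P Q v) (hT : 0 < T) (hf : Cadlag T f) :
    intD T f v = ∫ t, f t ∂P - ∫ t, f t ∂Q := by
  have := h.finite_left
  have := h.finite_right
  exact h.intD_eq (hf.integrable hT h.left_compl) (hf.integrable hT h.right_compl)

lemma abs_integral_sub_le_of_cadlag [IsFiniteMeasure P] (hP : P (Icc 0 T)ᶜ = 0) (hT : 0 < T)
    (hf : Cadlag T f) (hg : Cadlag T g) {ε : ℝ} (hfg : ∀ t ∈ Icc 0 T, |f t - g t| ≤ ε) :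
    |∫ t, f t ∂P - ∫ t, g t ∂P| ≤ ε * P.real univ := by
  rw [← integral_sub (hf.integrable hT hP) (hg.integrable hT hP), ← Real.norm_eq_abs]
  refine norm_integral_le_of_norm_le_const ?_
  filter_upwards [compl_mem_ae_iff.2 hP] with t ht
  exact hfg t (by simpa using ht)

lemma IsDiffRep.abs_intD_sub_le (h : IsDiffRep T P Q v) (hT : 0 < T) (hf : Cadlag T f)
    (hg : Cadlag T g) {ε : ℝ} (hfg : ∀ t ∈ Icc 0 T, |f t - g t| ≤ ε) :
    |intD T f v - intD T g v| ≤ ε * (P.real univ + Q.real univ) := by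
  have := h.finite_left
  have := h.finite_right
  rw [h.intD_eq_of_cadlag hT hf, h.intD_eq_of_cadlag hT hg]
  have h1 := abs_le.1 (abs_integral_sub_le_of_cadlag h.left_compl hT hf hg hfg)
  have h2 := abs_le.1 (abs_integral_sub_le_of_cadlag h.right_compl hT hf hg hfg)
  exact abs_le.2 ⟨by linarith, by linarith⟩

lemma IsDiffRep.intD_congr (h : IsDiffRep T P Q v) (hT : 0 < T) (hf : Cadlag T f)
    (hg : Cadlag T g) (hfg : ∀ t ∈ Icc 0 T, f t = g t) : intD T f v = intD T g v := by
  have := h.abs_intD_sub_le hT hf hg (ε := 0) fun t ht => by simp [hfg t ht]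
  rw [zero_mul] at this
  exact sub_eq_zero.1 (abs_eq_zero.1 (le_antisymm this (abs_nonneg _)))

lemma measure_Icc_zero_eq_Iic (hP : P (Icc 0 T)ᶜ = 0) {t : ℝ} (ht : t ≤ T) :
    P (Icc 0 t) = P (Iic t) := by
  rw [← measure_inter_conull hP (s := Iic t)]
  congr 1
  ext s
  simp only [mem_inter_iff, mem_Iic, mem_Icc]
  exact ⟨fun h => ⟨h.2, h.1, h.2.trans ht⟩, fun h => ⟨h.2.1, h.1⟩⟩

lemma measure_univ_eq_Iic (hP : P (Icc 0 T)ᶜ = 0) : P univ = P (Iic T) := by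
  rw [← measure_inter_conull hP (s := univ), ← measure_inter_conull hP (s := Iic T)]
  congr 1
  ext s
  simp only [mem_inter_iff, mem_univ, true_and, mem_Iic, mem_Icc]
  exact ⟨fun h => ⟨h.2, h⟩, fun h => h.2⟩

lemma IsDiffRep.apply_Iic (h : IsDiffRep T P Q v) {t : ℝ} (ht : t ∈ Icc 0 T) :
    P.real (Iic t) - Q.real (Iic t) = v t := by
  rw [← h.apply_Icc t ht, Measure.real, Measure.real, Measure.real, Measure.real,
    measure_Icc_zero_eq_Iic h.left_compl ht.2, measure_Icc_zero_eq_Iic h.right_compl ht.2]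

lemma IsDiffRep.apply_univ (h : IsDiffRep T P Q v) (hT : 0 < T) :
    P.real univ - Q.real univ = v T := by
  rw [← h.apply_Iic ⟨hT.le, le_rfl⟩, Measure.real, Measure.real, Measure.real, Measure.real,
    measure_univ_eq_Iic h.left_compl, measure_univ_eq_Iic h.right_compl]

lemma cadlag_const (T c : ℝ) : Cadlag T fun _ => c := continuousOn_const.cadlag

lemma IsDiffRep.intD_one (h : IsDiffRep T P Q v) (hT : 0 < T) :
    intD T (fun _ => 1) v = v T := by
  rw [h.intD_eq_of_cadlag hT (cadlag_const T 1), ← h.apply_univ hT]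
  simp

lemma tendsto_measureReal_Iic [IsFiniteMeasure P] {u : ℕ → ℝ} {s : ℝ} (hu : StrictMono u)
    (hus : ∀ n, u n < s) (hlim : Tendsto u atTop (𝓝 s)) :
    Tendsto (fun n => P.real (Iic (u n))) atTop (𝓝 (P.real (Iio s))) := by
  have hU : Iio s = ⋃ n, Iic (u n) := by
    ext t
    simp only [mem_Iio, mem_iUnion, mem_Iic]
    refine ⟨fun ht => ?_, fun ⟨n, hn⟩ => hn.trans_lt (hus n)⟩
    obtain ⟨n, hn⟩ := (hlim.eventually (lt_mem_nhds ht)).exists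
    exact ⟨n, hn.le⟩
  rw [hU]
  refine (ENNReal.tendsto_toReal (measure_ne_top P _)).comp ?_
  exact tendsto_measure_iUnion_atTop fun m n hmn => Iic_subset_Iic.2 (hu.monotone hmn)

lemma IsDiffRep.apply_Ici (h : IsDiffRep T P Q v) (hT : 0 < T) (hv : ContinuousOn v (Icc 0 T))
    (hv0 : v 0 = 0) {s : ℝ} (hs : s ∈ Icc 0 T) :
    P.real (Ici s) - Q.real (Ici s) = v T - v s := by
  have := h.finite_left
  have := h.finite_right
  have hIio : P.real (Iio s) - Q.real (Iio s) = v s := by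
    rcases hs.1.eq_or_lt with rfl | hpos
    · have hsub : Iio (0:ℝ) ⊆ (Icc 0 T)ᶜ := fun t ht h' => absurd h'.1 (not_le.2 ht)
      simp [Measure.real, measure_mono_null hsub h.left_compl,
        measure_mono_null hsub h.right_compl, hv0]
    · obtain ⟨u, hu, hus, hlim⟩ := exists_seq_strictMono_tendsto' hpos
      have huI : ∀ n, u n ∈ Icc 0 T := fun n => ⟨(hus n).1.le, (hus n).2.le.trans hs.2⟩
      have h1 := (tendsto_measureReal_Iic (P := P) hu (fun n => (hus n).2) hlim).sub
        (tendsto_measureReal_Iic (P := Q) hu (fun n => (hus n).2) hlim)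
      have h2 : Tendsto (fun n => v (u n)) atTop (𝓝 (v s)) :=
        (hv s hs).tendsto.comp (tendsto_nhdsWithin_iff.2 ⟨hlim, Eventually.of_forall huI⟩)
      refine tendsto_nhds_unique h1 (h2.congr fun n => ?_)
      exact (h.apply_Iic (huI n)).symm
  have e : ∀ M : Measure ℝ, IsFiniteMeasure M → M.real (Ici s) = M.real univ - M.real (Iio s) :=
    fun M _ => by rw [← compl_Iio, measureReal_compl measurableSet_Iio]
  rw [e P inferInstance, e Q inferInstance, ← h.apply_univ hT, ← hIio]
  ring

lemma integral_measureReal_Iic (M N : Measure ℝ) [IsFiniteMeasure M] [IsFiniteMeasure N] :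
    ∫ t, M.real (Iic t) ∂N = ∫ s, N.real (Ici s) ∂M := by
  have hS : MeasurableSet {p : ℝ × ℝ | p.1 ≤ p.2} := measurableSet_le measurable_fst measurable_snd
  have m1 : Measurable fun t => M (Iic t) :=
    Monotone.measurable fun a b hab => measure_mono (Iic_subset_Iic.2 hab)
  have m2 : Measurable fun s => N (Ici s) :=
    Antitone.measurable fun a b hab => measure_mono (Ici_subset_Ici.2 hab)
  simp only [Measure.real]
  rw [integral_toReal m1.aemeasurable (Eventually.of_forall fun _ => measure_lt_top _ _),
    integral_toReal m2.aemeasurable (Eventually.of_forall fun _ => measure_lt_top _ _)]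
  congr 1
  have h1 := Measure.prod_apply (μ := M) (ν := N) hS
  have h2 := Measure.prod_apply_symm (μ := M) (ν := N) hS
  exact h2.symm.trans h1

lemma integrable_measureReal_Iic (M N : Measure ℝ) [IsFiniteMeasure M] [IsFiniteMeasure N] :
    Integrable (fun t => M.real (Iic t)) N := by
  refine Integrable.of_bound (C := M.real univ) (Monotone.measurable fun a b hab =>
    measureReal_mono (Iic_subset_Iic.2 hab)).aestronglyMeasurable (Eventually.of_forall fun t => ?_)
  rw [Real.norm_of_nonneg measureReal_nonneg]
  exact measureReal_mono (subset_univ _)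

lemma integrable_measureReal_Ici (M N : Measure ℝ) [IsFiniteMeasure M] [IsFiniteMeasure N] :
    Integrable (fun t => M.real (Ici t)) N := by
  refine Integrable.of_bound (C := M.real univ) (Antitone.measurable fun a b hab =>
    measureReal_mono (Ici_subset_Ici.2 hab)).aestronglyMeasurable (Eventually.of_forall fun t => ?_)
  rw [Real.norm_of_nonneg measureReal_nonneg]
  exact measureReal_mono (subset_univ _)

/-- Integration by parts for a càdlàg integrand and a continuous integrator. -/
lemma IsDiffRep.intD_parts {A : ℝ → ℝ} {P' Q' : Measure ℝ} (hA : IsDiffRep T P Q A)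
    (hv : IsDiffRep T P' Q' v) (hT : 0 < T) (hAc : ContinuousOn A (Icc 0 T)) (hA0 : A 0 = 0)
    (hvc : Cadlag T v) : intD T v A = v T * A T - intD T A v := by
  have := hA.finite_left
  have := hA.finite_right
  have := hv.finite_left
  have := hv.finite_right
  have hconv : ∀ M : Measure ℝ, IsFiniteMeasure M → M (Icc 0 T)ᶜ = 0 →
      ∫ t, v t ∂M = ∫ s, M.real (Ici s) ∂P' - ∫ s, M.real (Ici s) ∂Q' := by
    intro M _ hM
    rw [← integral_measureReal_Iic, ← integral_measureReal_Iic,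
      ← integral_sub (integrable_measureReal_Iic _ _) (integrable_measureReal_Iic _ _)]
    refine integral_congr_ae ?_
    filter_upwards [compl_mem_ae_iff.2 hM] with t ht
    exact (hv.apply_Iic (by simpa using ht)).symm
  have hconv' : ∀ M : Measure ℝ, IsFiniteMeasure M → M (Icc 0 T)ᶜ = 0 →
      ∫ s, P.real (Ici s) ∂M - ∫ s, Q.real (Ici s) ∂M = A T * M.real univ - ∫ s, A s ∂M := by
    intro M _ hM
    have hc : ∫ _, A T ∂M = A T * M.real univ := by simp [mul_comm]
    rw [← integral_sub (integrable_measureReal_Ici _ _) (integrable_measureReal_Ici _ _), ← hc,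
      ← integral_sub (integrable_const _) (hAc.cadlag.integrable hT hM)]
    refine integral_congr_ae ?_
    filter_upwards [compl_mem_ae_iff.2 hM] with s hs
    exact hA.apply_Ici hT hAc hA0 (by simpa using hs)
  rw [hA.intD_eq_of_cadlag hT hvc, hv.intD_eq_of_cadlag hT hAc.cadlag,
    hconv P inferInstance hA.left_compl, hconv Q inferInstance hA.right_compl, ← hv.apply_univ hT]
  have h1 := hconv' P' inferInstance hv.left_compl
  have h2 := hconv' Q' inferInstance hv.right_compl
  linear_combination h1 - h2

end Integral

lemma MemV.exists_isDiffRep {T : ℝ} (hT : 0 < T) {v : ℝ → ℝ} (hv : MemV T v) :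
    ∃ P Q : Measure ℝ, IsDiffRep T P Q v := by
  obtain ⟨P, Q, h, -⟩ := _root_.exists_isDiffRep hT hv.1.1 hv.2
  exact ⟨P, Q, h⟩

lemma MemA.exists_isDiffRep {T : ℝ} (hT : 0 < T) {A : ℝ → ℝ} (hA : MemA T A) :
    ∃ P Q : Measure ℝ, IsDiffRep T P Q A ∧
      P.real univ + Q.real univ ≤ 3 * (eVariationOn A (Icc 0 T)).toReal := by
  obtain ⟨P, Q, h, h'⟩ := _root_.exists_isDiffRep hT hA.1.cadlag.1 hA.2.1
  exact ⟨P, Q, h, by simpa [hA.2.2] using h'⟩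

/-- A pointwise convergent sequence of integral functionals is uniformly bounded. -/
lemma exists_bound_intD {T : ℝ} (hT : 0 < T) {v : ℕ → ℝ → ℝ} (hv : ∀ n, MemV T (v n))
    (hconv : ∀ f : ℝ → ℝ, Continuous f → ∃ l, Tendsto (fun n => intD T f (v n)) atTop (𝓝 l)) :
    ∃ C, 0 ≤ C ∧ ∀ n, ∀ g : ℝ → ℝ, ContinuousOn g (Icc 0 T) → ∀ δ, 0 ≤ δ →
      (∀ t ∈ Icc 0 T, |g t| ≤ δ) → |intD T g (v n)| ≤ C * δ := by
  choose P Q hPQ using fun n => (hv n).exists_isDiffRep hT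
  have hcad : ∀ f : C(Icc (0:ℝ) T, ℝ), Cadlag T (IccExtend hT.le f) := fun f =>
    (f.continuous.Icc_extend').continuousOn.cadlag
  let ℓ : ℕ → C(Icc (0:ℝ) T, ℝ) →L[ℝ] ℝ := fun n => LinearMap.mkContinuous
    { toFun := fun f => intD T (IccExtend hT.le f) (v n)
      map_add' := fun f g => by
        have := (hPQ n).finite_left
        have := (hPQ n).finite_right
        rw [(hPQ n).intD_eq_of_cadlag hT (hcad _), (hPQ n).intD_eq_of_cadlag hT (hcad _),
          (hPQ n).intD_eq_of_cadlag hT (hcad _)]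
        have e : ∀ t, IccExtend hT.le (f + g) t = IccExtend hT.le f t + IccExtend hT.le g t :=
          fun t => rfl
        simp only [e]
        rw [integral_add ((hcad f).integrable hT (hPQ n).left_compl)
            ((hcad g).integrable hT (hPQ n).left_compl),
          integral_add ((hcad f).integrable hT (hPQ n).right_compl)
            ((hcad g).integrable hT (hPQ n).right_compl)]
        ring
      map_smul' := fun c f => by
        rw [(hPQ n).intD_eq_of_cadlag hT (hcad _), (hPQ n).intD_eq_of_cadlag hT (hcad _)]
        have e : ∀ t, IccExtend hT.le (c • f) t = c * IccExtend hT.le f t := fun t => rfl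
        simp only [e, integral_const_mul, RingHom.id_apply, smul_eq_mul]
        ring }
    ((P n).real univ + (Q n).real univ) fun f => by
      have h := (hPQ n).abs_intD_sub_le hT (hcad f) (cadlag_const T 0) (ε := ‖f‖) fun t _ => by
        simpa [IccExtend] using f.norm_coe_le_norm (projIcc 0 T hT.le t)
      have h0 : intD T (fun _ => 0) (v n) = 0 := by
        rw [(hPQ n).intD_eq_of_cadlag hT (cadlag_const T 0)]; simp
      rw [h0, sub_zero, mul_comm] at h
      exact h
  have hℓ : ∀ n f, ℓ n f = intD T (IccExtend hT.le f) (v n) := fun n f => rfl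
  obtain ⟨C, hC⟩ := banach_steinhaus (g := ℓ) fun f => by
    obtain ⟨l, hl⟩ := hconv (IccExtend hT.le f) f.continuous.Icc_extend'
    obtain ⟨C, hC⟩ := hl.norm.bddAbove_range
    exact ⟨C, fun n => hC ⟨n, rfl⟩⟩
  refine ⟨C, (norm_nonneg _).trans (hC 0), fun n g hg δ hδ hgδ => ?_⟩
  let f : C(Icc (0:ℝ) T, ℝ) := ⟨(Icc 0 T).domRestrict g, hg.domRestrict⟩
  have hfg : intD T g (v n) = ℓ n f := by
    rw [hℓ]
    refine (hPQ n).intD_congr hT hg.cadlag (hcad f) fun t ht => ?_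
    rw [IccExtend_of_mem _ _ ht]; rfl
  have hf : ‖f‖ ≤ δ := (ContinuousMap.norm_le f hδ).2 fun t => hgδ t t.2
  rw [hfg, ← Real.norm_eq_abs]
  calc ‖ℓ n f‖ ≤ ‖ℓ n‖ * ‖f‖ := (ℓ n).le_opNorm f
    _ ≤ C * δ := mul_le_mul (hC n) hf (norm_nonneg _) ((norm_nonneg _).trans (hC 0))

lemma tendsto_of_approx {a : ℕ → ℝ} {a₀ K : ℝ} (hK : 0 ≤ K)
    (h : ∀ ε > 0, ∃ (b : ℕ → ℝ) (b₀ : ℝ), Tendsto b atTop (𝓝 b₀) ∧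
      (∀ n, |a n - b n| ≤ K * ε) ∧ |a₀ - b₀| ≤ K * ε) : Tendsto a atTop (𝓝 a₀) := by
  refine Metric.tendsto_atTop.2 fun δ hδ => ?_
  obtain ⟨b, b₀, hb, h1, h2⟩ := h (δ / (4 * (K + 1))) (by positivity)
  have hKδ : K * (δ / (4 * (K + 1))) ≤ δ / 4 := by
    rw [mul_div_assoc', div_le_div_iff₀ (by positivity) (by norm_num)]
    nlinarith
  obtain ⟨N, hN⟩ := Metric.tendsto_atTop.1 hb (δ / 4) (by positivity)
  refine ⟨N, fun n hn => ?_⟩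
  have e1 := abs_le.1 ((h1 n).trans hKδ)
  have e2 := abs_le.1 (h2.trans hKδ)
  have e3 := hN n hn
  rw [Real.dist_eq, abs_lt] at e3 ⊢
  constructor <;> linarith [e1.1, e1.2, e2.1, e2.2, e3.1, e3.2]

/-- Weak convergence of the càdlàg integrands gives convergence of the integrals against
`τ`-convergent integrators. -/
lemma tendsto_intD_of_weak {T : ℝ} (hT : 0 < T) {v : ℕ → ℝ → ℝ} {v₀ : ℝ → ℝ}
    (hv : ∀ n, MemV T (v n)) (hv₀ : MemV T v₀)
    (hweak : ∀ f : ℝ → ℝ, Continuous f →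
      Tendsto (fun n => intD T f (v n)) atTop (𝓝 (intD T f v₀)))
    {A : ℕ → ℝ → ℝ} {A₀ : ℝ → ℝ} (hA : ∀ n, MemA T (A n)) (hA₀ : MemA T A₀)
    (hAA : TendstoUniformlyOn A A₀ atTop (Icc 0 T)) :
    Tendsto (fun n => intD T (v n) (A n)) atTop (𝓝 (intD T v₀ A₀)) := by
  choose P Q hPQ using fun n => (hv n).exists_isDiffRep hT
  obtain ⟨P₀, Q₀, hPQ₀⟩ := hv₀.exists_isDiffRep hT
  have hparts : ∀ n, intD T (v n) (A n) = v n T * A n T - intD T (A n) (v n) := fun n => by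
    obtain ⟨_, _, h, -⟩ := (hA n).exists_isDiffRep hT
    exact h.intD_parts (hPQ n) hT (hA n).1 (hA n).2.2 (hv n).1
  have hparts₀ : intD T v₀ A₀ = v₀ T * A₀ T - intD T A₀ v₀ := by
    obtain ⟨_, _, h, -⟩ := hA₀.exists_isDiffRep hT
    exact h.intD_parts hPQ₀ hT hA₀.1 hA₀.2.2 hv₀.1
  simp only [hparts, hparts₀]
  have hTm : T ∈ Icc 0 T := ⟨hT.le, le_rfl⟩
  have hvT : Tendsto (fun n => v n T) atTop (𝓝 (v₀ T)) := by
    have := hweak _ (continuous_const (y := (1:ℝ)))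
    rw [hPQ₀.intD_one hT] at this
    exact this.congr fun n => (hPQ n).intD_one hT
  refine (hvT.mul (hAA.tendsto_at hTm)).sub ?_
  have hA₀v : Tendsto (fun n => intD T A₀ (v n)) atTop (𝓝 (intD T A₀ v₀)) := by
    have hc : Continuous (IccExtend hT.le ((Icc 0 T).domRestrict A₀)) :=
      hA₀.1.domRestrict.Icc_extend'
    have he : ∀ t ∈ Icc 0 T, IccExtend hT.le ((Icc 0 T).domRestrict A₀) t = A₀ t :=
      fun t ht => by rw [IccExtend_of_mem _ _ ht]; rfl
    have := hweak _ hc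
    rw [hPQ₀.intD_congr hT hc.continuousOn.cadlag hA₀.1.cadlag he] at this
    exact this.congr fun n => (hPQ n).intD_congr hT hc.continuousOn.cadlag hA₀.1.cadlag he
  obtain ⟨C, hC0, hC⟩ := exists_bound_intD hT hv fun f hf => ⟨_, hweak f hf⟩
  refine tendsto_of_tendsto_of_dist hA₀v ?_
  refine Metric.tendsto_atTop.2 fun δ hδ => ?_
  obtain ⟨N, hN⟩ := eventually_atTop.1
    (Metric.tendstoUniformlyOn_iff.1 hAA (δ / (2 * (C + 1))) (by positivity))
  refine ⟨N, fun n hn => ?_⟩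
  have hsub : intD T A₀ (v n) - intD T (A n) (v n) = intD T (fun t => A₀ t - A n t) (v n) := by
    have := (hPQ n).finite_left
    have := (hPQ n).finite_right
    rw [(hPQ n).intD_eq_of_cadlag hT hA₀.1.cadlag, (hPQ n).intD_eq_of_cadlag hT (hA n).1.cadlag,
      (hPQ n).intD_eq_of_cadlag hT
        (show Cadlag T (fun t => A₀ t - A n t) from (hA₀.1.sub (hA n).1).cadlag),
      integral_sub (hA₀.1.cadlag.integrable hT (hPQ n).left_compl)
        ((hA n).1.cadlag.integrable hT (hPQ n).left_compl),
      integral_sub (hA₀.1.cadlag.integrable hT (hPQ n).right_compl)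
        ((hA n).1.cadlag.integrable hT (hPQ n).right_compl)]
    ring
  have hb := hC n (fun t => A₀ t - A n t) (hA₀.1.sub (hA n).1) (δ / (2 * (C + 1)))
    (by positivity) fun t ht => by
    have := hN n hn t ht
    rw [Real.dist_eq] at this
    exact this.le
  have hlt : C * (δ / (2 * (C + 1))) < δ := by
    rw [mul_div_assoc', div_lt_iff₀ (by positivity)]
    nlinarith
  rw [Real.dist_0_eq_abs, abs_of_nonneg dist_nonneg, Real.dist_eq, hsub]
  exact hb.trans_lt hlt

lemma SConv.tendsto_endpoint {T : ℝ} (hT : 0 < T) {x : ℕ → ℝ → ℝ} {x₀ : ℝ → ℝ}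
    (h : SConv T x x₀) : Tendsto (fun n => x n T) atTop (𝓝 (x₀ T)) := by
  have hTm : T ∈ Icc 0 T := ⟨hT.le, le_rfl⟩
  refine tendsto_of_approx zero_le_one fun ε hε => ?_
  obtain ⟨v, v₀, hv, hv₀, h1, h2, h3⟩ := h ε hε
  refine ⟨fun n => v n T, v₀ T, ?_, fun n => by simpa using h1 n T hTm, by simpa using h2 T hTm⟩
  have := h3 _ (continuous_const (y := (1:ℝ)))
  obtain ⟨_, _, hr⟩ := hv₀.exists_isDiffRep hT
  rw [hr.intD_one hT] at this
  refine this.congr fun n => ?_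
  obtain ⟨_, _, hr⟩ := (hv n).exists_isDiffRep hT
  exact hr.intD_one hT

lemma SConv.tendsto_intD {T : ℝ} (hT : 0 < T) {x : ℕ → ℝ → ℝ} {x₀ : ℝ → ℝ}
    (hx : ∀ n, Cadlag T (x n)) (hx₀ : Cadlag T x₀) (h : SConv T x x₀)
    {A : ℕ → ℝ → ℝ} {A₀ : ℝ → ℝ} (hA : ∀ n, MemA T (A n)) (hA₀ : MemA T A₀)
    (hAA : TauConv T A A₀) :
    Tendsto (fun n => intD T (x n) (A n)) atTop (𝓝 (intD T x₀ A₀)) := by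
  obtain ⟨hu, M, hM⟩ := hAA
  choose P Q hPQ hmass using fun n => (hA n).exists_isDiffRep hT
  obtain ⟨P₀, Q₀, hPQ₀, -⟩ := hA₀.exists_isDiffRep hT
  have hmass' : ∀ n, (P n).real univ + (Q n).real univ ≤ 3 * max M 0 := fun n => by
    have : (eVariationOn (A n) (Icc 0 T)).toReal ≤ max M 0 := by
      rw [← ENNReal.toReal_ofReal']
      exact ENNReal.toReal_mono ENNReal.ofReal_ne_top (hM n)
    linarith [hmass n]
  have hm0 : 0 ≤ max M 0 := le_max_right _ _
  have hp0 : 0 ≤ P₀.real univ + Q₀.real univ := add_nonneg measureReal_nonneg measureReal_nonneg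
  refine tendsto_of_approx (K := 3 * max M 0 + (P₀.real univ + Q₀.real univ)) (by positivity)
    fun ε hε => ?_
  obtain ⟨v, v₀, hv, hv₀, h1, h2, h3⟩ := h ε hε
  refine ⟨_, _, tendsto_intD_of_weak hT hv hv₀ h3 hA hA₀ hu, fun n => ?_, ?_⟩
  · refine ((hPQ n).abs_intD_sub_le hT (hx n) (hv n).1 (h1 n)).trans ?_
    nlinarith [hmass' n]
  · refine (hPQ₀.abs_intD_sub_le hT hx₀ hv₀.1 h2).trans ?_
    nlinarith

lemma TauConv.comp {T : ℝ} {A : ℕ → ℝ → ℝ} {A₀ : ℝ → ℝ} (h : TauConv T A A₀) {φ : ℕ → ℕ}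
    (hφ : StrictMono φ) : TauConv T (fun k => A (φ k)) A₀ :=
  ⟨fun u hu => hφ.tendsto_atTop.eventually (h.1 u hu), h.2.imp fun _ hM n => hM (φ n)⟩

lemma tendsto_of_strictMono_subseq {a : ℕ → ℝ} {l : ℝ}
    (h : ∀ φ : ℕ → ℕ, StrictMono φ → ∃ ψ : ℕ → ℕ, StrictMono ψ ∧
      Tendsto (fun k => a (φ (ψ k))) atTop (𝓝 l)) : Tendsto a atTop (𝓝 l) := by
  refine tendsto_of_subseq_tendsto fun ns hns => ?_
  obtain ⟨θ, -, hθ⟩ := strictMono_subseq_of_tendsto_atTop hns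
  obtain ⟨ψ, -, hψ⟩ := h _ hθ
  exact ⟨fun k => θ (ψ k), hψ⟩

lemma SStarConv.closed_form {T : ℝ} (hT : 0 < T) {x : ℕ → ℝ → ℝ} {x₀ : ℝ → ℝ}
    (hx : ∀ n, Cadlag T (x n)) (hx₀ : Cadlag T x₀) (h : SStarConv T x x₀) :
    Tendsto (fun n => x n T) atTop (𝓝 (x₀ T)) ∧
      ∀ A : ℕ → ℝ → ℝ, ∀ A₀ : ℝ → ℝ, (∀ n, MemA T (A n)) → MemA T A₀ → TauConv T A A₀ →
        Tendsto (fun n => intD T (x n) (A n)) atTop (𝓝 (intD T x₀ A₀)) := by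
  refine ⟨tendsto_of_strictMono_subseq fun φ hφ => ?_, fun A A₀ hA hA₀ hAA =>
    tendsto_of_strictMono_subseq fun φ hφ => ?_⟩
  · obtain ⟨ψ, hψ, hS⟩ := h φ hφ
    exact ⟨ψ, hψ, hS.tendsto_endpoint hT⟩
  · obtain ⟨ψ, hψ, hS⟩ := h φ hφ
    exact ⟨ψ, hψ, hS.tendsto_intD hT (fun k => hx _) hx₀ (fun k => hA _) hA₀
      (hAA.comp (hφ.comp hψ))⟩

section Linear

variable {T : ℝ} {P Q P' Q' : Measure ℝ} {v w f : ℝ → ℝ}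

lemma IsDiffRep.add (h : IsDiffRep T P Q v) (h' : IsDiffRep T P' Q' w) :
    IsDiffRep T (P + P') (Q + Q') (fun t => v t + w t) := by
  have := h.finite_left
  have := h.finite_right
  have := h'.finite_left
  have := h'.finite_right
  refine ⟨inferInstance, inferInstance, ?_, ?_, fun t ht => ?_⟩
  · rw [Measure.add_apply, h.left_compl, h'.left_compl, add_zero]
  · rw [Measure.add_apply, h.right_compl, h'.right_compl, add_zero]
  · rw [measureReal_add_apply, measureReal_add_apply, ← h.apply_Icc t ht, ← h'.apply_Icc t ht]
    ring

lemma IsDiffRep.neg (h : IsDiffRep T P Q v) : IsDiffRep T Q P (fun t => -v t) :=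
  ⟨h.finite_right, h.finite_left, h.right_compl, h.left_compl,
    fun t ht => by rw [← h.apply_Icc t ht]; ring⟩

lemma IsDiffRep.smul (h : IsDiffRep T P Q v) (c : NNReal) :
    IsDiffRep T (c • P) (c • Q) (fun t => c * v t) := by
  have := h.finite_left
  have := h.finite_right
  refine ⟨inferInstance, inferInstance, ?_, ?_, fun t ht => ?_⟩
  · rw [Measure.smul_apply, h.left_compl, smul_zero]
  · rw [Measure.smul_apply, h.right_compl, smul_zero]
  · rw [measureReal_nnreal_smul_apply, measureReal_nnreal_smul_apply, ← h.apply_Icc t ht]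
    ring

lemma IsDiffRep.intD_add (h : IsDiffRep T P Q v) (h' : IsDiffRep T P' Q' w) (hT : 0 < T)
    (hf : Cadlag T f) : intD T f (fun t => v t + w t) = intD T f v + intD T f w := by
  have := h.finite_left
  have := h.finite_right
  have := h'.finite_left
  have := h'.finite_right
  rw [(h.add h').intD_eq_of_cadlag hT hf, h.intD_eq_of_cadlag hT hf, h'.intD_eq_of_cadlag hT hf,
    integral_add_measure (hf.integrable hT h.left_compl) (hf.integrable hT h'.left_compl),
    integral_add_measure (hf.integrable hT h.right_compl) (hf.integrable hT h'.right_compl)]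
  ring

lemma IsDiffRep.const_mul (h : IsDiffRep T P Q v) (hT : 0 < T) (c : ℝ) :
    ∃ P' Q' : Measure ℝ, IsDiffRep T P' Q' (fun t => c * v t) ∧
      ∀ f, Cadlag T f → intD T f (fun t => c * v t) = c * intD T f v := by
  rcases le_total 0 c with hc | hc
  · lift c to NNReal using hc
    refine ⟨_, _, h.smul c, fun f hf => ?_⟩
    rw [(h.smul c).intD_eq_of_cadlag hT hf, h.intD_eq_of_cadlag hT hf,
      integral_smul_nnreal_measure, integral_smul_nnreal_measure]
    simp only [NNReal.smul_def, smul_eq_mul]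
    ring
  · obtain ⟨d, rfl⟩ : ∃ d, c = -d := ⟨-c, by ring⟩
    lift d to NNReal using neg_nonpos.1 hc
    have h' := (h.smul d).neg
    simp only [← neg_mul] at h'
    refine ⟨_, _, h', fun f hf => ?_⟩
    rw [h'.intD_eq_of_cadlag hT hf, h.intD_eq_of_cadlag hT hf,
      integral_smul_nnreal_measure, integral_smul_nnreal_measure]
    simp only [NNReal.smul_def, smul_eq_mul]
    ring

lemma eVariationOn_add_le (f g : ℝ → ℝ) (s : Set ℝ) :
    eVariationOn (fun t => f t + g t) s ≤ eVariationOn f s + eVariationOn g s := by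
  refine iSup_le ?_
  rintro ⟨n, u, hu, us⟩
  refine le_trans ?_ (add_le_add (eVariationOn.sum_le (f := f) (n := n) hu us)
    (eVariationOn.sum_le (f := g) (n := n) hu us))
  rw [← Finset.sum_add_distrib]
  exact Finset.sum_le_sum fun i _ => edist_add_add_le _ _ _ _

lemma eVariationOn_const_mul_le (c : ℝ) (f : ℝ → ℝ) (s : Set ℝ) :
    eVariationOn (fun t => c * f t) s ≤ ENNReal.ofReal |c| * eVariationOn f s := by
  refine iSup_le ?_
  rintro ⟨n, u, hu, us⟩
  refine le_trans ?_ (mul_le_mul_right (eVariationOn.sum_le (f := f) (n := n) hu us) _)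
  rw [Finset.mul_sum]
  refine Finset.sum_le_sum fun i _ => ?_
  rw [edist_dist, edist_dist, ← ENNReal.ofReal_mul (abs_nonneg c), Real.dist_eq, Real.dist_eq,
    ← abs_mul, mul_sub]

lemma BoundedVariationOn.fun_add {s : Set ℝ} (hv : BoundedVariationOn v s)
    (hw : BoundedVariationOn w s) : BoundedVariationOn (fun t => v t + w t) s :=
  ne_top_of_le_ne_top (ENNReal.add_ne_top.2 ⟨hv, hw⟩) (eVariationOn_add_le v w s)

lemma BoundedVariationOn.const_mul {s : Set ℝ} (hv : BoundedVariationOn v s) (c : ℝ) :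
    BoundedVariationOn (fun t => c * v t) s :=
  ne_top_of_le_ne_top (ENNReal.mul_ne_top ENNReal.ofReal_ne_top hv)
    (eVariationOn_const_mul_le c v s)

lemma Cadlag.fun_add (hv : Cadlag T v) (hw : Cadlag T w) : Cadlag T (fun t => v t + w t) := by
  refine ⟨fun t ht => (hv.1 t ht).add (hw.1 t ht), fun t ht => ?_⟩
  obtain ⟨a, ha⟩ := hv.2 t ht
  obtain ⟨b, hb⟩ := hw.2 t ht
  exact ⟨a + b, ha.add hb⟩

lemma Cadlag.const_mul (hv : Cadlag T v) (c : ℝ) : Cadlag T (fun t => c * v t) :=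
  ⟨fun t ht => (hv.1 t ht).const_mul c, fun t ht => (hv.2 t ht).imp' (c * ·)
    fun _ ha => ha.const_mul c⟩

lemma MemA.fun_add (hv : MemA T v) (hw : MemA T w) : MemA T (fun t => v t + w t) :=
  ⟨hv.1.add hw.1, hv.2.1.fun_add hw.2.1, by simp [hv.2.2, hw.2.2]⟩

lemma MemA.const_mul (hv : MemA T v) (c : ℝ) : MemA T (fun t => c * v t) :=
  ⟨continuousOn_const.mul hv.1, hv.2.1.const_mul c, by simp [hv.2.2]⟩

lemma MemA.intD_add (hv : MemA T v) (hw : MemA T w) (hT : 0 < T) (hf : Cadlag T f) :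
    intD T f (fun t => v t + w t) = intD T f v + intD T f w := by
  obtain ⟨_, _, h, -⟩ := hv.exists_isDiffRep hT
  obtain ⟨_, _, h', -⟩ := hw.exists_isDiffRep hT
  exact h.intD_add h' hT hf

lemma MemA.intD_const_mul (hv : MemA T v) (hT : 0 < T) (hf : Cadlag T f) (c : ℝ) :
    intD T f (fun t => c * v t) = c * intD T f v := by
  obtain ⟨_, _, h, -⟩ := hv.exists_isDiffRep hT
  obtain ⟨_, _, -, h'⟩ := h.const_mul hT c
  exact h' f hf

lemma memA_zero (T : ℝ) : MemA T fun _ => 0 :=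
  ⟨continuousOn_const, by
    rw [BoundedVariationOn, eVariationOn.constant_on]
    · exact ENNReal.zero_ne_top
    · exact subsingleton_singleton.anti (image_subset_iff.2 fun _ _ => rfl), rfl⟩

lemma intD_zero_right (hT : 0 < T) (hf : Cadlag T f) : intD T f (fun _ => 0) = 0 := by
  simpa using (memA_zero T).intD_const_mul hT hf 0

end Linear

section StepFunctions

variable {T : ℝ} {c a : ℕ → ℝ}

lemma isDiffRep_dirac {s : ℝ} (hs : s ∈ Icc 0 T) :
    IsDiffRep T (Measure.dirac s) 0 (fun t => if s ≤ t then 1 else 0) := by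
  refine ⟨inferInstance, inferInstance, by simp [hs.1, hs.2], by simp, fun t ht => ?_⟩
  by_cases h : s ≤ t <;> simp [Measure.real, h, hs.1]

lemma memV_heaviside (T s : ℝ) : MemV T (fun t => if s ≤ t then 1 else 0) := by
  have hmono : Monotone fun t : ℝ => if s ≤ t then (1:ℝ) else 0 := fun t u htu => by
    by_cases h : s ≤ t
    · simp [h, h.trans htu]
    · simp only [h, if_false]; split_ifs <;> norm_num
  refine ⟨⟨fun t _ => ?_, fun t _ => ?_⟩, (hmono.monotoneOn _).boundedVariationOn (C := 1)
    fun t _ => by split_ifs <;> simp⟩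
  · by_cases h : s ≤ t
    · refine tendsto_const_nhds.congr' ?_
      filter_upwards [self_mem_nhdsWithin] with u hu
      simp [h, h.trans (le_of_lt hu)]
    · refine tendsto_const_nhds.congr' ?_
      filter_upwards [mem_nhdsWithin_of_mem_nhds (Iio_mem_nhds (not_le.1 h))] with u hu
      simp [h, not_le.2 (mem_Iio.1 hu)]
  · exact ⟨_, hmono.tendsto_nhdsLT t⟩

lemma stepFn_succ_eq (K : ℕ) (c a : ℕ → ℝ) : stepFn (K + 1) c a =
    fun t => stepFn K c a t + c (K + 1) * (if a (K + 1) ≤ t then 1 else 0) := by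
  ext t
  rw [stepFn, Finset.sum_range_succ, stepFn, mul_ite, mul_one, mul_zero]

lemma stepFn_zero_eq (c a : ℕ → ℝ) :
    stepFn 0 c a = fun t => c 0 * (if a 0 ≤ t then 1 else 0) := by
  ext t
  simp [stepFn]

lemma memV_stepFn (T : ℝ) (K : ℕ) (c a : ℕ → ℝ) : MemV T (stepFn K c a) := by
  induction K with
  | zero =>
    rw [stepFn_zero_eq]
    exact ⟨(memV_heaviside T _).1.const_mul _, (memV_heaviside T _).2.const_mul _⟩
  | succ K ih =>
    rw [stepFn_succ_eq]
    exact ⟨ih.1.fun_add ((memV_heaviside T _).1.const_mul _),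
      ih.2.fun_add ((memV_heaviside T _).2.const_mul _)⟩

lemma intD_heaviside (hT : 0 < T) {s : ℝ} (hs : s ∈ Icc 0 T) {f : ℝ → ℝ} (hf : Cadlag T f) :
    intD T f (fun t => if s ≤ t then 1 else 0) = f s := by
  rw [(isDiffRep_dirac hs).intD_eq_of_cadlag hT hf]
  simp

lemma intD_stepFn (hT : 0 < T) (ha : ∀ j, a j ∈ Icc 0 T) (K : ℕ) {f : ℝ → ℝ} (hf : Cadlag T f) :
    intD T f (stepFn K c a) = ∑ j ∈ Finset.range (K + 1), c j * f (a j) := by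
  induction K with
  | zero =>
    obtain ⟨_, _, -, h⟩ := (isDiffRep_dirac (ha 0)).const_mul hT (c 0)
    rw [stepFn_zero_eq, h f hf, intD_heaviside hT (ha 0) hf]
    simp
  | succ K ih =>
    obtain ⟨_, _, h', h⟩ := (isDiffRep_dirac (ha (K + 1))).const_mul hT (c (K + 1))
    obtain ⟨_, _, hK⟩ := (memV_stepFn T K c a).exists_isDiffRep hT
    rw [stepFn_succ_eq, hK.intD_add h' hT hf, h f hf, intD_heaviside hT (ha _) hf, ih,
      Finset.sum_range_succ _ (K + 1)]

end StepFunctions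

/-- The continuous ramp rising linearly from `0` at `s` to `1` at `s + h`. -/
def ramp (s h r : ℝ) : ℝ := max (min ((r - s) / h) 1) 0

section Ramp

variable {T s h : ℝ}

lemma ramp_nonneg (s h r : ℝ) : 0 ≤ ramp s h r := le_max_right _ _

lemma ramp_le_one (s h r : ℝ) : ramp s h r ≤ 1 := max_le (min_le_right _ _) zero_le_one

lemma ramp_anti (hh : 0 < h) {u : ℝ} (hsu : s ≤ u) (r : ℝ) : ramp u h r ≤ ramp s h r := by
  unfold ramp
  gcongr

lemma monotone_ramp (s : ℝ) (hh : 0 < h) : Monotone (ramp s h) := fun a b hab => by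
  unfold ramp
  gcongr

lemma continuous_ramp (s h : ℝ) : Continuous (ramp s h) := by
  unfold ramp
  fun_prop

lemma eVariationOn_ramp_le (hT : 0 < T) (s : ℝ) (hh : 0 < h) :
    eVariationOn (ramp s h) (Icc 0 T) ≤ 1 := by
  have := ((monotone_ramp s hh).monotoneOn (Icc 0 T)).eVariationOn_eq
    (left_mem_Icc.2 hT.le) (right_mem_Icc.2 hT.le)
  rw [inter_self] at this
  rw [this]
  refine ENNReal.ofReal_le_one.2 ?_
  linarith [ramp_nonneg s h 0, ramp_le_one s h T]

lemma memA_ramp (hT : 0 < T) (hs : 0 ≤ s) (hh : 0 < h) : MemA T (ramp s h) := by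
  refine ⟨(continuous_ramp s h).continuousOn,
    ne_top_of_le_ne_top ENNReal.one_ne_top (eVariationOn_ramp_le hT s hh), max_eq_right ?_⟩
  refine (min_le_left _ _).trans (div_nonpos_of_nonpos_of_nonneg (by linarith) hh.le)

lemma isDiffRep_ramp (hs : 0 ≤ s) (hh : 0 < h) (hsT : s + h ≤ T) :
    IsDiffRep T (h⁻¹.toNNReal • volume.restrict (Ioc s (s + h))) 0 (ramp s h) := by
  refine ⟨inferInstance, inferInstance, ?_, by simp, fun t ht => ?_⟩
  · rw [Measure.smul_apply, Measure.restrict_apply measurableSet_Icc.compl]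
    have : (Icc 0 T)ᶜ ∩ Ioc s (s + h) = ∅ := by
      rw [inter_comm, ← sdiff_eq]
      exact sdiff_eq_empty.2 fun r hr => ⟨hs.trans hr.1.le, hr.2.trans hsT⟩
    simp [this]
  · have hi : Icc 0 t ∩ Ioc s (s + h) = Ioc s (min t (s + h)) := by
      ext r
      simp only [mem_inter_iff, mem_Icc, mem_Ioc, le_min_iff]
      exact ⟨fun h => ⟨h.2.1, h.1.2, h.2.2⟩, fun h => ⟨⟨hs.trans h.1.le, h.2.1⟩, h.1, h.2.2⟩⟩
    rw [measureReal_nnreal_smul_apply, measureReal_restrict_apply measurableSet_Icc, hi,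
      Real.volume_real_Ioc, Real.coe_toNNReal _ (inv_nonneg.2 hh.le), ramp,
      mul_max_of_nonneg _ _ (inv_nonneg.2 hh.le), ← min_sub_sub_right,
      mul_min_of_nonneg _ _ (inv_nonneg.2 hh.le)]
    have h1 : h⁻¹ * (s + h - s) = 1 := by field_simp; ring
    have h2 : h⁻¹ * (t - s) = (t - s) / h := by field_simp
    rw [h1, h2]
    simp

lemma tendsto_intD_ramp {x : ℝ → ℝ} (hx : Cadlag T x) (hs : s ∈ Ico 0 T) :
    Tendsto (fun h => intD T x (ramp s h)) (𝓝[>] 0) (𝓝 (x s)) := by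
  have hT : 0 < T := hs.1.trans_lt hs.2
  refine Metric.tendsto_nhds.2 fun δ hδ => ?_
  obtain ⟨b, hb, hb'⟩ := mem_nhdsGT_iff_exists_Ioo_subset.1
    (Metric.tendsto_nhds.1 (hx.1 s hs) (δ / 2) (half_pos hδ))
  have hb0 : 0 < b - s := sub_pos.2 hb
  filter_upwards [Ioo_mem_nhdsGT hb0, Ioo_mem_nhdsGT (sub_pos.2 hs.2)] with h hh hh'
  have hrep := isDiffRep_ramp hs.1 hh.1 (show s + h ≤ T by linarith [hh'.2])
  have hfin := hrep.finite_left
  rw [hrep.intD_eq_of_cadlag hT hx, integral_zero_measure, sub_zero]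
  set P := h⁻¹.toNNReal • volume.restrict (Ioc s (s + h)) with hP
  have hP1 : P.real univ = 1 := by
    rw [hP, measureReal_nnreal_smul_apply, measureReal_restrict_apply_univ,
      Real.volume_real_Ioc_of_le (by linarith [hh.1]), Real.coe_toNNReal _ (inv_nonneg.2 hh.1.le)]
    have := hh.1.ne'
    field_simp
    ring
  have hc : x s = ∫ _, x s ∂P := by simp [hP1]
  rw [hc, Real.dist_eq, ← integral_sub (hx.integrable hT hrep.left_compl) (integrable_const _),
    ← Real.norm_eq_abs]
  refine (norm_integral_le_of_norm_le_const (C := δ / 2) ?_).trans_lt (by rw [hP1]; linarith)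
  refine Measure.ae_smul_measure ?_ _
  filter_upwards [ae_restrict_mem measurableSet_Ioc] with r hr
  have : dist (x r) (x s) < δ / 2 := hb' ⟨hr.1, by linarith [hr.2, hh.2]⟩
  rw [Real.dist_eq] at this
  exact this.le

end Ramp

/-- An oscillating path is detected by a uniformly small integrator. -/
lemma Osc.exists_memA {T ε : ℝ} (hT : 0 < T) {x : ℝ → ℝ} (hx : Cadlag T x) {k : ℕ} {t : ℝ}
    (ho : Osc x ε k t) (ht : t < T) :
    ∀ᶠ h in 𝓝[>] (0:ℝ), ∃ A, MemA T A ∧ (∀ r, |A r| ≤ ramp 0 h r - ramp t h r) ∧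
      eVariationOn A (Icc 0 T) ≤ ENNReal.ofReal (2 * k) ∧ k * ε ≤ intD T x A := by
  induction k generalizing t with
  | zero =>
    filter_upwards [self_mem_nhdsWithin] with h hh
    refine ⟨_, memA_zero T, fun r => ?_, ?_, by simp [intD_zero_right hT hx]⟩
    · rw [abs_zero, sub_nonneg]
      exact ramp_anti hh ho.nonneg r
    · rw [eVariationOn.constant_on
        (subsingleton_singleton.anti (image_subset_iff.2 fun _ _ => rfl))]
      exact zero_le
  | succ k ih =>
    obtain ⟨s, u, hs, hsu, hut, hε⟩ := ho
    have hs0 := hs.nonneg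
    have hu0 := hs0.trans hsu.le
    have hlim := ((tendsto_intD_ramp hx ⟨hu0, hut.trans_lt ht⟩).sub
      (tendsto_intD_ramp hx ⟨hs0, (hsu.trans_le hut).trans ht⟩)).abs
    filter_upwards [ih hs ((hsu.trans_le hut).trans ht), hlim.eventually (lt_mem_nhds hε),
      self_mem_nhdsWithin] with h ⟨A, hA, hAr, hAv, hAx⟩ hgt hh
    have hh : 0 < h := hh
    have key : ∀ σ : ℝ, |σ| = 1 →
        σ * (intD T x (ramp u h) - intD T x (ramp s h)) =
          |intD T x (ramp u h) - intD T x (ramp s h)| →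
        ∃ A, MemA T A ∧ (∀ r, |A r| ≤ ramp 0 h r - ramp t h r) ∧
          eVariationOn A (Icc 0 T) ≤ ENNReal.ofReal (2 * (k + 1 : ℕ)) ∧
          (k + 1 : ℕ) * ε ≤ intD T x A := by
      intro σ hσ hσx
      have hu := (memA_ramp hT hu0 hh).const_mul σ
      have hs' := (memA_ramp hT hs0 hh).const_mul (-σ)
      refine ⟨_, hA.fun_add (hu.fun_add hs'), fun r => ?_, ?_, ?_⟩
      · have e1 := ramp_anti hh hut r
        have e2 := ramp_anti hh hsu.le r
        have e3 : |σ * ramp u h r + -σ * ramp s h r| = ramp s h r - ramp u h r := by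
          rw [show σ * ramp u h r + -σ * ramp s h r = σ * (ramp u h r - ramp s h r) by ring,
            abs_mul, hσ, one_mul, abs_sub_comm, abs_of_nonneg (by linarith)]
        have := abs_add_le (A r) (σ * ramp u h r + -σ * ramp s h r)
        linarith [hAr r]
      · refine (eVariationOn_add_le _ _ _).trans ?_
        have h1 : ∀ σ' p : ℝ, |σ'| = 1 →
            eVariationOn (fun r => σ' * ramp p h r) (Icc 0 T) ≤ ENNReal.ofReal 1 := by
          intro σ' p hσ'
          refine (eVariationOn_const_mul_le _ _ _).trans ?_
          rw [hσ', ENNReal.ofReal_one, one_mul]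
          exact eVariationOn_ramp_le hT p hh
        refine (add_le_add hAv ((eVariationOn_add_le _ _ _).trans
          (add_le_add (h1 σ u hσ) (h1 (-σ) s (by rwa [abs_neg]))))).trans ?_
        rw [← ENNReal.ofReal_add zero_le_one zero_le_one,
          ← ENNReal.ofReal_add (by positivity) (by norm_num)]
        refine ENNReal.ofReal_le_ofReal ?_
        push_cast
        linarith
      · rw [hA.intD_add (hu.fun_add hs') hT hx, hu.intD_add hs' hT hx,
          (memA_ramp hT hu0 hh).intD_const_mul hT hx, (memA_ramp hT hs0 hh).intD_const_mul hT hx]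
        push_cast
        linarith
    rcases le_total 0 (intD T x (ramp u h) - intD T x (ramp s h)) with h0 | h0
    · exact key 1 (by simp) (by rw [abs_of_nonneg h0, one_mul])
    · exact key (-1) (by simp) (by rw [abs_of_nonpos h0]; ring)

section Tightness

variable {T : ℝ} {x : ℕ → ℝ → ℝ} {x₀ : ℝ → ℝ}

lemma false_of_frequently_small_integrator (hT : 0 < T) (hx₀ : Cadlag T x₀)
    (hconv : ∀ A : ℕ → ℝ → ℝ, ∀ A₀ : ℝ → ℝ, (∀ n, MemA T (A n)) → MemA T A₀ → TauConv T A A₀ →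
      Tendsto (fun n => intD T (x n) (A n)) atTop (𝓝 (intD T x₀ A₀)))
    {η M : ℝ} (hη : 0 < η)
    (h : ∀ k : ℕ, ∃ᶠ n in atTop, ∃ A, MemA T A ∧ (∀ r, |A r| ≤ 1 / ((k:ℝ) + 1)) ∧
      eVariationOn A (Icc 0 T) ≤ ENNReal.ofReal M ∧ η ≤ intD T (x n) A) : False := by
  obtain ⟨φ, hφ, hφA⟩ := extraction_forall_of_frequently h
  choose A hA hAr hAv hAx using hφA
  let B : ℕ → ℝ → ℝ := Function.extend φ A fun _ _ => 0
  have hB : ∀ k, B (φ k) = A k := hφ.injective.extend_apply A _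
  have hB' : ∀ n, (¬ ∃ k, φ k = n) → B n = fun _ => 0 := fun n hn => Function.extend_apply' _ _ _ hn
  have hBA : ∀ n, MemA T (B n) := fun n => by
    by_cases hn : ∃ k, φ k = n
    · obtain ⟨k, rfl⟩ := hn
      rw [hB]; exact hA k
    · rw [hB' n hn]; exact memA_zero T
  have hτ : TauConv T B fun _ => 0 := by
    refine ⟨Metric.tendstoUniformlyOn_iff.2 fun δ hδ => ?_, M, fun n => ?_⟩
    · obtain ⟨K, hK⟩ := exists_nat_one_div_lt hδ
      filter_upwards [eventually_ge_atTop (φ K)] with n hn r _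
      by_cases hn' : ∃ k, φ k = n
      · obtain ⟨k, rfl⟩ := hn'
        have hKk : (K:ℝ) ≤ k := Nat.cast_le.2 (hφ.le_iff_le.1 hn)
        rw [hB, dist_comm, Real.dist_0_eq_abs]
        exact ((hAr k r).trans (one_div_le_one_div_of_le (by positivity) (by linarith))).trans_lt hK
      · simpa [hB' n hn'] using hδ
    · by_cases hn : ∃ k, φ k = n
      · obtain ⟨k, rfl⟩ := hn
        rw [hB]; exact hAv k
      · rw [hB' n hn, eVariationOn.constant_on
          (subsingleton_singleton.anti (image_subset_iff.2 fun _ _ => rfl))]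
        exact zero_le
  have hlim := (hconv B _ hBA (memA_zero T) hτ).comp hφ.tendsto_atTop
  rw [intD_zero_right hT hx₀] at hlim
  refine absurd (ge_of_tendsto' hlim fun k => ?_) (not_le.2 hη)
  simpa [hB] using hAx k

lemma exists_forall_of_eventually {p : ℕ → ℕ → Prop} (hp : ∀ n, Monotone (p n))
    (hev : ∃ K, ∀ᶠ n in atTop, p n K) (hex : ∀ n, ∃ K, p n K) : ∃ K, ∀ n, p n K := by
  obtain ⟨K, hK⟩ := hev
  obtain ⟨N, hN⟩ := eventually_atTop.1 hK
  choose L hL using hex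
  refine ⟨K + ∑ n ∈ Finset.range N, L n, fun n => ?_⟩
  rcases le_or_gt N n with hn | hn
  · exact hp n (Nat.le_add_right _ _) (hN n hn)
  · exact hp n ((Finset.single_le_sum (fun _ _ => Nat.zero_le _)
      (Finset.mem_range.2 hn)).trans (Nat.le_add_left _ _)) (hL n)

lemma exists_oscTime_eq_uniform (hT : 0 < T) (hx : ∀ n, Cadlag T (x n)) (hx₀ : Cadlag T x₀)
    (hconv : ∀ A : ℕ → ℝ → ℝ, ∀ A₀ : ℝ → ℝ, (∀ n, MemA T (A n)) → MemA T A₀ → TauConv T A A₀ →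
      Tendsto (fun n => intD T (x n) (A n)) atTop (𝓝 (intD T x₀ A₀)))
    {ε : ℝ} (hε : 0 < ε) : ∃ K, ∀ n, oscTime T (x n) ε K = T := by
  refine exists_forall_of_eventually (p := fun n K => oscTime T (x n) ε K = T)
    (fun n K L hKL h => le_antisymm (oscTime_mem hT L).2
      (h.symm.trans_le (oscTime_monotone hT hKL)))
    ?_ fun n => exists_oscTime_eq hT hε (hx n)
  by_contra! hcon
  refine false_of_frequently_small_integrator hT hx₀ hconv (M := 2) hε fun k => ?_
  refine (hcon (k + 1)).mono fun n hn => ?_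
  obtain ⟨t, ht, htT⟩ := exists_between (lt_of_le_of_ne (oscTime_mem hT _).2 hn)
  obtain ⟨h, A, hA, hAr, hAv, hAx⟩ :=
    ((osc_of_oscTime_lt htT ht).exists_memA hT (hx n) htT).exists
  have hk : (0:ℝ) < (k:ℝ) + 1 := by positivity
  push_cast at hAv hAx
  refine ⟨_, hA.const_mul (1 / ((k:ℝ) + 1)), fun r => ?_, ?_, ?_⟩
  · rw [abs_mul, abs_of_pos (one_div_pos.2 hk)]
    refine mul_le_of_le_one_right (one_div_pos.2 hk).le ((hAr r).trans ?_)
    linarith [ramp_le_one 0 h r, ramp_nonneg t h r]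
  · refine (eVariationOn_const_mul_le _ _ _).trans ((mul_le_mul_right hAv _).trans_eq ?_)
    rw [abs_of_pos (one_div_pos.2 hk), ← ENNReal.ofReal_mul (one_div_pos.2 hk).le]
    congr 1
    field_simp
  · rw [hA.intD_const_mul hT (hx n), one_div, ← div_eq_inv_mul, le_div_iff₀ hk]
    linarith

lemma exists_bound_uniform (hT : 0 < T) (hx : ∀ n, Cadlag T (x n)) (hx₀ : Cadlag T x₀)
    (hxT : Tendsto (fun n => x n T) atTop (𝓝 (x₀ T)))
    (hconv : ∀ A : ℕ → ℝ → ℝ, ∀ A₀ : ℝ → ℝ, (∀ n, MemA T (A n)) → MemA T A₀ → TauConv T A A₀ →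
      Tendsto (fun n => intD T (x n) (A n)) atTop (𝓝 (intD T x₀ A₀))) :
    ∃ C : ℕ, ∀ n, ∀ t ∈ Icc 0 T, |x n t| ≤ C := by
  refine exists_forall_of_eventually (p := fun n K => ∀ t ∈ Icc 0 T, |x n t| ≤ K)
    (fun n K L hKL h t ht => (h t ht).trans (Nat.cast_le.2 hKL)) ?_ fun n => ?_
  swap
  · obtain ⟨C, hC⟩ := (hx n).exists_bound hT
    obtain ⟨K, hK⟩ := exists_nat_ge C
    exact ⟨K, fun t ht => (hC t ht).trans hK⟩
  by_contra! hcon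
  obtain ⟨B, hB⟩ := exists_nat_gt |x₀ T|
  refine false_of_frequently_small_integrator hT hx₀ hconv (M := 1) one_pos fun k => ?_
  refine ((hcon (k + 1 + B)).and_eventually (hxT.abs.eventually (gt_mem_nhds hB))).mono ?_
  rintro n ⟨⟨t, ht, hxt⟩, hn⟩
  push_cast at hxt
  have hB0 : (0:ℝ) ≤ B := B.cast_nonneg
  have hk : (0:ℝ) < (k:ℝ) + 1 := by positivity
  have htT : t < T := lt_of_le_of_ne ht.2 fun h => by rw [h] at hxt; linarith
  have hlim := (tendsto_intD_ramp (hx n) ⟨ht.1, htT⟩).abs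
  obtain ⟨h, hgt, hh⟩ := ((hlim.eventually (lt_mem_nhds hxt)).and self_mem_nhdsWithin).exists
  have hh : 0 < h := hh
  have hR := memA_ramp hT ht.1 hh
  have key : ∀ σ : ℝ, |σ| = 1 → σ * intD T (x n) (ramp t h) = |intD T (x n) (ramp t h)| →
      ∃ A, MemA T A ∧ (∀ r, |A r| ≤ 1 / ((k:ℝ) + 1)) ∧
        eVariationOn A (Icc 0 T) ≤ ENNReal.ofReal 1 ∧ 1 ≤ intD T (x n) A := by
    intro σ hσ hσx
    have habs : |σ / ((k:ℝ) + 1)| = 1 / ((k:ℝ) + 1) := by rw [abs_div, hσ, abs_of_pos hk]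
    refine ⟨_, hR.const_mul (σ / ((k:ℝ) + 1)), fun r => ?_, ?_, ?_⟩
    · rw [abs_mul, habs, abs_of_nonneg (ramp_nonneg _ _ _)]
      exact mul_le_of_le_one_right (one_div_pos.2 hk).le (ramp_le_one _ _ _)
    · refine (eVariationOn_const_mul_le _ _ _).trans ?_
      rw [habs, ENNReal.ofReal_one]
      refine mul_le_one' (ENNReal.ofReal_le_one.2 ?_) (eVariationOn_ramp_le hT t hh)
      rw [div_le_one hk]
      linarith [k.cast_nonneg (α := ℝ)]
    · rw [hR.intD_const_mul hT (hx n), div_mul_eq_mul_div, hσx, le_div_iff₀ hk]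
      linarith
  rcases le_total 0 (intD T (x n) (ramp t h)) with h0 | h0
  · exact key 1 (by simp) (by rw [abs_of_nonneg h0, one_mul])
  · exact key (-1) (by simp) (by rw [abs_of_nonpos h0]; ring)

end Tightness

/-- A uniform distance bound passes to the limit when both sequences of integrals converge. -/
lemma abs_sub_le_of_tendsto_intD {T ε : ℝ} (hT : 0 < T) {x v : ℕ → ℝ → ℝ} {x₀ v₀ : ℝ → ℝ}
    (hx : ∀ n, Cadlag T (x n)) (hx₀ : Cadlag T x₀) (hv : ∀ n, Cadlag T (v n)) (hv₀ : Cadlag T v₀)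
    (hxv : ∀ n, ∀ t ∈ Icc 0 T, |x n t - v n t| ≤ ε)
    (hxl : ∀ A, MemA T A → Tendsto (fun n => intD T (x n) A) atTop (𝓝 (intD T x₀ A)))
    (hvl : ∀ A, MemA T A → Tendsto (fun n => intD T (v n) A) atTop (𝓝 (intD T v₀ A)))
    {s : ℝ} (hs : s ∈ Ico 0 T) : |x₀ s - v₀ s| ≤ ε := by
  refine le_of_tendsto ((tendsto_intD_ramp hx₀ hs).sub (tendsto_intD_ramp hv₀ hs)).abs ?_
  filter_upwards [Ioo_mem_nhdsGT (sub_pos.2 hs.2)] with h hh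
  have hA := memA_ramp hT hs.1 hh.1
  have hrep := isDiffRep_ramp hs.1 hh.1 (show s + h ≤ T by linarith [hh.2])
  have hmass := hrep.apply_univ hT
  have hε : 0 ≤ ε := (abs_nonneg _).trans (hxv 0 s ⟨hs.1, hs.2.le⟩)
  refine le_of_tendsto' ((hxl _ hA).sub (hvl _ hA)).abs fun n => ?_
  refine (hrep.abs_intD_sub_le hT (hx n) (hv n) (hxv n)).trans (mul_le_of_le_one_right hε ?_)
  have h0 : (0 : Measure ℝ).real univ = 0 := measureReal_zero_apply _
  linarith [ramp_le_one s h T]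

lemma abs_increments_le {x : ℝ → ℝ} {a : ℕ → ℝ} {C : ℝ} (h : ∀ j, |x (a j)| ≤ C) (j : ℕ) :
    |increments x a j| ≤ 2 * C := by
  cases j with
  | zero => exact (h 0).trans (by linarith [(abs_nonneg _).trans (h 0)])
  | succ j => exact (abs_sub _ _).trans (by linarith [h j, h (j + 1)])

lemma tendsto_intD_stepFn {T : ℝ} (hT : 0 < T) (K : ℕ) {c a : ℕ → ℕ → ℝ} {c₀ a₀ : ℕ → ℝ}
    (ha : ∀ n j, a n j ∈ Icc 0 T) (ha₀ : ∀ j, a₀ j ∈ Icc 0 T)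
    (hc : ∀ j, Tendsto (fun n => c n j) atTop (𝓝 (c₀ j)))
    (haa : ∀ j, Tendsto (fun n => a n j) atTop (𝓝 (a₀ j))) {f : ℝ → ℝ} (hf : Continuous f) :
    Tendsto (fun n => intD T f (stepFn K (c n) (a n))) atTop (𝓝 (intD T f (stepFn K c₀ a₀))) := by
  simp only [intD_stepFn hT (ha _) K hf.continuousOn.cadlag,
    intD_stepFn hT ha₀ K hf.continuousOn.cadlag]
  exact tendsto_finsetSum _ fun j _ => (hc j).mul ((hf.tendsto _).comp (haa j))

lemma SStarConv.of_closed_form {T : ℝ} (hT : 0 < T) {x : ℕ → ℝ → ℝ} {x₀ : ℝ → ℝ}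
    (hx : ∀ n, Cadlag T (x n)) (hx₀ : Cadlag T x₀)
    (hxT : Tendsto (fun n => x n T) atTop (𝓝 (x₀ T)))
    (hconv : ∀ A : ℕ → ℝ → ℝ, ∀ A₀ : ℝ → ℝ, (∀ n, MemA T (A n)) → MemA T A₀ → TauConv T A A₀ →
      Tendsto (fun n => intD T (x n) (A n)) atTop (𝓝 (intD T x₀ A₀))) :
    SStarConv T x x₀ := by
  intro φ hφ
  have hpos : ∀ m : ℕ, (0:ℝ) < 1 / (m + 1) := fun m => Nat.one_div_pos_of_nat
  choose K hK using fun m => exists_oscTime_eq_uniform hT hx hx₀ hconv (hpos m)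
  obtain ⟨C, hC⟩ := exists_bound_uniform hT hx hx₀ hxT hconv
  let a : ℕ → ℕ → ℕ → ℝ := fun n m => oscTime T (x n) (1 / ((m:ℝ) + 1))
  let c : ℕ → ℕ → ℕ → ℝ := fun n m => increments (x n) (a n m)
  have ha : ∀ n m j, a n m j ∈ Icc 0 T := fun n m j => oscTime_mem hT j
  have hS : IsCompact (univ.pi fun _ : ℕ => univ.pi fun _ : ℕ =>
      Icc (-(2 * C : ℝ)) (2 * C) ×ˢ Icc 0 T) :=
    isCompact_univ_pi fun _ => isCompact_univ_pi fun _ => isCompact_Icc.prod isCompact_Icc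
  obtain ⟨z, hz, ψ, hψ, hlim⟩ := hS.tendsto_subseq
    (x := fun k m j => (c (φ k) m j, a (φ k) m j)) fun k m _ j _ =>
      ⟨abs_le.1 (abs_increments_le (fun i => hC _ _ (ha _ _ i)) j), ha _ _ j⟩
  have hlim' : ∀ m j, Tendsto (fun k => (c (φ (ψ k)) m j, a (φ (ψ k)) m j)) atTop (𝓝 (z m j)) :=
    fun m j => tendsto_pi_nhds.1 (tendsto_pi_nhds.1 hlim m) j
  have hθ := hφ.comp hψ
  refine ⟨ψ, hψ, fun ε hε => ?_⟩
  obtain ⟨m, hm⟩ := exists_nat_one_div_lt hε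
  have hvV : ∀ k, MemV T (stepFn (K m) (c (φ (ψ k)) m) (a (φ (ψ k)) m)) :=
    fun k => memV_stepFn T _ _ _
  have hv₀V : MemV T (stepFn (K m) (fun j => (z m j).1) fun j => (z m j).2) := memV_stepFn T _ _ _
  have hclose : ∀ k, ∀ t ∈ Icc 0 T,
      |x (φ (ψ k)) t - stepFn (K m) (c (φ (ψ k)) m) (a (φ (ψ k)) m) t| ≤ ε := fun k t ht =>
    (abs_sub_stepFn_oscTime_le hT (hpos m) (hx _) (hK m _) ht).trans hm.le
  have hweak : ∀ f : ℝ → ℝ, Continuous f → Tendsto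
      (fun k => intD T f (stepFn (K m) (c (φ (ψ k)) m) (a (φ (ψ k)) m))) atTop
      (𝓝 (intD T f (stepFn (K m) (fun j => (z m j).1) fun j => (z m j).2))) := fun f hf =>
    tendsto_intD_stepFn hT (K m) (fun k j => ha _ _ j) (fun j => (hz m trivial j trivial).2)
      (fun j => (hlim' m j).fst_nhds) (fun j => (hlim' m j).snd_nhds) hf
  refine ⟨_, _, hvV, hv₀V, hclose, fun t ht => ?_, hweak⟩
  rcases ht.2.eq_or_lt with rfl | htT
  · have hvT : Tendsto (fun k => stepFn (K m) (c (φ (ψ k)) m) (a (φ (ψ k)) m) t) atTop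
        (𝓝 (stepFn (K m) (fun j => (z m j).1) (fun j => (z m j).2) t)) := by
      have h1 : ∀ v, MemV t v → intD t (fun _ => 1) v = v t := fun v hv => by
        obtain ⟨_, _, hr⟩ := hv.exists_isDiffRep hT
        exact hr.intD_one hT
      have := hweak _ (continuous_const (y := (1:ℝ)))
      simpa only [h1 _ hv₀V, h1 _ (hvV _)] using this
    exact le_of_tendsto' (((hxT.comp hθ.tendsto_atTop).sub hvT).abs) fun k => hclose k t ht
  · refine abs_sub_le_of_tendsto_intD hT (fun k => hx _) hx₀ (fun k => (hvV k).1) hv₀V.1 hclose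
      (fun A hA => ?_) (fun A hA => ?_) ⟨ht.1, htT⟩
    · have hτ : TauConv T (fun _ => A) A :=
        ⟨fun u hu => Eventually.of_forall fun _ t _ => refl_mem_uniformity hu,
          _, fun _ => (ENNReal.ofReal_toReal hA.2.1).ge⟩
      exact (hconv _ A (fun _ => hA) hA hτ).comp hθ.tendsto_atTop
    · exact tendsto_intD_of_weak hT hvV hv₀V hweak (fun _ => hA) hA fun u hu =>
        Eventually.of_forall fun _ t _ => refl_mem_uniformity hu

/-- Closed form of convergence in the `S` topology (Theorem 3.2). -/
theorem stmt1 (T : ℝ) (hT : 0 < T) (x : ℕ → ℝ → ℝ) (x₀ : ℝ → ℝ)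
    (hx : ∀ n, Cadlag T (x n)) (hx₀ : Cadlag T x₀) :
    SStarConv T x x₀ ↔
      (Filter.Tendsto (fun n => x n T) Filter.atTop (nhds (x₀ T)) ∧
        ∀ A : ℕ → ℝ → ℝ, ∀ A₀ : ℝ → ℝ,
          (∀ n, MemA T (A n)) → MemA T A₀ → TauConv T A A₀ →
          Filter.Tendsto (fun n => intD T (x n) (A n)) Filter.atTop
            (nhds (intD T x₀ A₀))) := by
  exact ⟨fun h => h.closed_form hT hx hx₀, fun h => .of_closed_form hT hx hx₀ h.1 h.2⟩

end
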